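/- There exists a non-atomic, homogeneously multifractal (HM) Borel probability measure μ on [0,1] whose multifractal spectrum satisfies d_μ(h) = h for every h ∈ [0,1], d_μ(2) = 0, and d_μ(h) = −∞ for every h ∈ [0,∞) \ ([0,1] ∪ {2}). In particular, Support(d_μ) = [0,1] ∪ {2}, which is not an interval. -/

import Mathlib

open MeasureTheory Metric Filter Set
open scoped ENNReal Topology
open Classical

/-- The lower local dimension (local Hölder exponent) of a measure `μ` on `ℝ` at `x`:
`liminf_{r → 0⁺} log μ(B(x,r)) / log r`, with the convention that it is `+∞`
when `x` does not belong to the support of `μ`. -/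
noncomputable def locDim (μ : Measure ℝ) (x : ℝ) : EReal :=
  if ∀ r : ℝ, 0 < r → 0 < μ (ball x r) then
    Filter.liminf
      (fun r : ℝ => ((Real.log ((μ (ball x r)).toReal) / Real.log r : ℝ) : EReal))
      (nhdsWithin 0 (Set.Ioi 0))
  else ⊤

/-- Hausdorff dimension of a set, with the convention `dim ∅ = -∞`. -/
noncomputable def dimHE (s : Set ℝ) : EReal :=
  if s.Nonempty then ((dimH s : ℝ≥0∞) : EReal) else ⊥

/-- The multifractal spectrum of a measure supported in `[0,1]`:
`d_μ(h) = dim_H {x ∈ [0,1] : h_μ(x) = h}`, with `dim ∅ = -∞`. -/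
noncomputable def spec (μ : Measure ℝ) (h : EReal) : EReal :=
  dimHE {x ∈ Set.Icc (0:ℝ) 1 | locDim μ x = h}

/-- A measure supported in `[0,1]` is homogeneously multifractal (HM) if its restriction to any
non-degenerate subinterval of `[0,1]` has the same multifractal spectrum as the whole measure. -/
def IsHM (μ : Measure ℝ) : Prop :=
  ∀ a b : ℝ, 0 ≤ a → a < b → b ≤ 1 →
    ∀ h : EReal, 0 ≤ h →
      dimHE {x ∈ Set.Ioo a b | locDim μ x = h} = spec μ h

section LocalDimension

variable {μ : Measure ℝ} {x s : ℝ}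

/-- Near `0`, a power lower bound for the mass of balls is a bound on the logarithmic ratio. -/
theorem log_div_log_le_iff {m r t : ℝ} (hr : 0 < r) (hr1 : r < 1) (hm : 0 < m) :
    Real.log m / Real.log r ≤ t ↔ r ^ t ≤ m := by
  rw [div_le_iff_of_neg (Real.log_neg hr hr1), ← Real.log_rpow hr,
    Real.log_le_log_iff (Real.rpow_pos_of_pos hr t) hm]

theorem eventually_mem_Ioo_zero {δ : ℝ} (hδ : 0 < δ) : ∀ᶠ r : ℝ in 𝓝[>] 0, r ∈ Ioo 0 δ :=
  Ioo_mem_nhdsGT hδ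

theorem locDim_eq_liminf (h : ∀ r : ℝ, 0 < r → 0 < μ (ball x r)) :
    locDim μ x = liminf
      (fun r : ℝ => ((Real.log ((μ (ball x r)).toReal) / Real.log r : ℝ) : EReal))
      (𝓝[>] 0) := if_pos h

theorem ball_pos_of_frequently {t : ℝ} (h : ∃ᶠ r : ℝ in 𝓝[>] 0, r ^ t ≤ μ.real (ball x r)) :
    ∀ r : ℝ, 0 < r → 0 < μ (ball x r) := by
  intro r hr
  obtain ⟨r', h1, h2⟩ := (h.and_eventually (eventually_mem_Ioo_zero hr)).exists
  have h3 : 0 < μ.real (ball x r') := (Real.rpow_pos_of_pos h2.1 t).trans_le h1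
  have h4 : 0 < μ (ball x r') := by
    by_contra h5
    simp [Measure.real, nonpos_iff_eq_zero.1 (not_lt.1 h5)] at h3
  exact h4.trans_le (measure_mono (ball_subset_ball h2.2.le))

theorem locDim_le_of_frequently
    (h : ∀ t > s, ∃ᶠ r : ℝ in 𝓝[>] 0, r ^ t ≤ μ.real (ball x r)) : locDim μ x ≤ (s : EReal) := by
  have hpos := ball_pos_of_frequently (h (s + 1) (by linarith))
  rw [locDim_eq_liminf hpos, ← EReal.le_of_forall_lt_iff_le]
  intro t ht
  apply liminf_le_of_frequently_le'
  refine ((h t (by exact_mod_cast ht)).and_eventually (eventually_mem_Ioo_zero one_pos)).mono ?_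
  rintro r ⟨h1, h2⟩
  exact_mod_cast (log_div_log_le_iff h2.1 h2.2
    ((Real.rpow_pos_of_pos h2.1 t).trans_le h1)).2 h1

theorem frequently_of_locDim_lt [IsFiniteMeasure μ] (h : locDim μ x < (s : EReal)) :
    ∃ᶠ r : ℝ in 𝓝[>] 0, r ^ s ≤ μ.real (ball x r) := by
  by_cases hpos : ∀ r : ℝ, 0 < r → 0 < μ (ball x r)
  · rw [locDim_eq_liminf hpos] at h
    refine ((frequently_lt_of_liminf_lt (by isBoundedDefault) h).and_eventually
      (eventually_mem_Ioo_zero one_pos)).mono ?_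
    rintro r ⟨h1, h2⟩
    have hm : 0 < μ.real (ball x r) := ENNReal.toReal_pos (hpos r h2.1).ne' (measure_ne_top _ _)
    exact (log_div_log_le_iff h2.1 h2.2 hm).1 (by exact_mod_cast h1.le)
  · rw [locDim, if_neg hpos] at h
    exact absurd h not_top_lt

theorem le_locDim_of_eventually [IsFiniteMeasure μ]
    (h : ∀ t < s, ∀ᶠ r : ℝ in 𝓝[>] 0, μ.real (ball x r) < r ^ t) : (s : EReal) ≤ locDim μ x := by
  by_contra! hlt
  obtain ⟨t, h1, h2⟩ := EReal.lt_iff_exists_real_btwn.1 hlt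
  obtain ⟨r, h3, h4⟩ := ((frequently_of_locDim_lt h1).and_eventually
    (h t (by exact_mod_cast h2))).exists
  exact absurd h3 (not_le.2 h4)

theorem locDim_nonneg [IsProbabilityMeasure μ] (x : ℝ) : 0 ≤ locDim μ x := by
  refine le_locDim_of_eventually (s := 0) fun t ht => ?_
  filter_upwards [eventually_mem_Ioo_zero one_pos] with r hr
  exact measureReal_le_one.trans_lt (Real.one_lt_rpow_of_pos_of_lt_one_of_neg hr.1 hr.2 ht)

/-- Bounds along a sequence of radii suffice to bound the lower local dimension from above. -/
theorem locDim_le_of_seq {r : ℕ → ℝ} (hr0 : ∀ k, 0 < r k) (hr : Tendsto r atTop (𝓝 0))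
    (h : ∀ t > s, ∃ᶠ k in atTop, r k ^ t ≤ μ.real (ball x (r k))) : locDim μ x ≤ (s : EReal) :=
  locDim_le_of_frequently fun t ht =>
    (tendsto_nhdsWithin_iff.2 ⟨hr, Eventually.of_forall hr0⟩).frequently (h t ht)

theorem hausdorffMeasure_frequently_ball_eq_zero [IsFiniteMeasure μ] {q : ℝ} (hs : 0 < s)
    (hq : q < s) :
    μH[s] {x : ℝ | ∃ᶠ r : ℝ in 𝓝[>] 0, r ^ q ≤ μ.real (ball x r)} = 0 := by
  set E := {x : ℝ | ∃ᶠ r : ℝ in 𝓝[>] 0, r ^ q ≤ μ.real (ball x r)} with hE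
  let δ : ℕ → ℝ := fun n => 1 / ((n : ℝ) + 1)
  have hδ : ∀ n, 0 < δ n := fun n => Nat.one_div_pos_of_nat
  have hδ0 : Tendsto δ atTop (𝓝 0) := tendsto_one_div_add_atTop_nhds_zero_nat
  have hex : ∀ n x, ∃ r : ℝ, x ∈ E → (0 < r ∧ r < δ n ∧ r ^ q ≤ μ.real (ball x r)) := by
    intro n x
    by_cases hx : x ∈ E
    · obtain ⟨r, h1, h2⟩ := (hx.and_eventually (eventually_mem_Ioo_zero (hδ n))).exists
      exact ⟨r, fun _ => ⟨h2.1, h2.2, h1⟩⟩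
    · exact ⟨0, fun h => absurd h hx⟩
  choose r hr using hex
  have hvit := fun n => Vitali.exists_disjoint_subfamily_covering_enlargement_closedBall
    E (fun x : ℝ => x) (r n) (δ n) (fun a ha => (hr n a ha).2.1.le) 5 (by norm_num)
  choose u huE hdisj hcov using hvit
  have hcount : ∀ n, (u n).Countable := fun n =>
    (hdisj n).countable_of_nonempty_interior fun i hi =>
      ⟨i, ball_subset_interior_closedBall (mem_ball_self (hr n i (huE n hi)).1)⟩
  have : ∀ n, Countable (u n) := fun n => (hcount n).to_subtype
  have hdiam : ∀ n (i : u n), ediam (closedBall (i : ℝ) (5 * r n i)) ≤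
      ENNReal.ofReal (10 * r n i) := fun n i => by
    rw [Real.closedBall_eq_Icc, Real.ediam_Icc]
    exact ENNReal.ofReal_le_ofReal (by linarith)
  have hsum : ∀ n, ∑' i : u n, ediam (closedBall (i : ℝ) (5 * r n i)) ^ s ≤
      ENNReal.ofReal (10 ^ s * δ n ^ (s - q)) * μ univ := by
    intro n
    have hterm : ∀ i : u n, ediam (closedBall (i : ℝ) (5 * r n i)) ^ s ≤
        ENNReal.ofReal (10 ^ s * δ n ^ (s - q)) * μ (closedBall (i : ℝ) (r n i)) := by
      intro i
      obtain ⟨h0, h1, h2⟩ := hr n i (huE n i.2)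
      have h3 : (10 * r n i) ^ s ≤
          10 ^ s * δ n ^ (s - q) * μ.real (closedBall (i : ℝ) (r n i)) := by
        rw [Real.mul_rpow (by norm_num) h0.le, mul_assoc]
        gcongr
        calc (r n i) ^ s = (r n i) ^ (s - q) * (r n i) ^ q := by
              rw [← Real.rpow_add h0]; congr 1; ring
          _ ≤ δ n ^ (s - q) * μ.real (closedBall (i : ℝ) (r n i)) := by
              gcongr
              exact h2.trans (measureReal_mono ball_subset_closedBall)
      calc _ ≤ ENNReal.ofReal (10 * r n i) ^ s := by gcongr; exact hdiam n i
        _ = ENNReal.ofReal ((10 * r n i) ^ s) :=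
            ENNReal.ofReal_rpow_of_nonneg (by positivity) hs.le
        _ ≤ ENNReal.ofReal (10 ^ s * δ n ^ (s - q) * μ.real (closedBall (i : ℝ) (r n i))) :=
            ENNReal.ofReal_le_ofReal h3
        _ = _ := by
            rw [ENNReal.ofReal_mul (by have := hδ n; positivity), ofReal_measureReal]
    refine (ENNReal.tsum_le_tsum hterm).trans ?_
    rw [ENNReal.tsum_mul_left]
    gcongr
    refine tsum_measure_le_measure_univ (fun i => measurableSet_closedBall.nullMeasurableSet) ?_
    intro i j hij
    exact (hdisj n i.2 j.2 (fun h => hij (Subtype.ext h))).aedisjoint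
  have hlim : Tendsto (fun n => ENNReal.ofReal (10 ^ s * δ n ^ (s - q)) * μ univ) atTop (𝓝 0) := by
    have h1 : Tendsto (fun n => 10 ^ s * δ n ^ (s - q)) atTop (𝓝 0) := by
      have := (hδ0.rpow_const (p := s - q) (Or.inr (by linarith))).const_mul ((10:ℝ) ^ s)
      rwa [Real.zero_rpow (by linarith), mul_zero] at this
    have h2 := ENNReal.tendsto_ofReal h1
    rw [ENNReal.ofReal_zero] at h2
    have := ENNReal.Tendsto.mul_const h2 (Or.inr (measure_ne_top μ univ))
    rwa [zero_mul] at this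
  have hr0 : Tendsto (fun n => ENNReal.ofReal (10 * δ n)) atTop (𝓝 0) := by
    have := ENNReal.tendsto_ofReal (hδ0.const_mul 10)
    rwa [mul_zero, ENNReal.ofReal_zero] at this
  refine le_antisymm ?_ (zero_le)
  refine (Measure.hausdorffMeasure_le_liminf_tsum s E _ hr0
    (fun n (i : u n) => closedBall (i : ℝ) (5 * r n i)) (Eventually.of_forall fun n i => ?_)
    (Eventually.of_forall fun n x hx => ?_)).trans ?_
  · refine (hdiam n i).trans (ENNReal.ofReal_le_ofReal ?_)
    have := (hr n i (huE n i.2)).2.1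
    linarith
  · obtain ⟨b, hb, hsub⟩ := hcov n x hx
    exact mem_iUnion.2 ⟨⟨b, hb⟩, hsub (mem_closedBall_self (hr n x hx).1.le)⟩
  · exact (liminf_le_liminf (Eventually.of_forall hsum)).trans hlim.liminf_eq.le

theorem hausdorffMeasure_locDim_lt_eq_zero [IsFiniteMeasure μ] (hs : 0 < s) :
    μH[s] {x : ℝ | locDim μ x < (s : EReal)} = 0 := by
  refine measure_mono_null (t := ⋃ q : {q : ℚ // (q : ℝ) < s},
    {x : ℝ | ∃ᶠ r : ℝ in 𝓝[>] 0, r ^ ((q : ℚ) : ℝ) ≤ μ.real (ball x r)}) ?_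
    (measure_iUnion_null fun q => hausdorffMeasure_frequently_ball_eq_zero hs q.2)
  intro x hx
  obtain ⟨q, h1, h2⟩ := EReal.lt_iff_exists_rat_btwn.1 (show locDim μ x < (s : EReal) from hx)
  exact mem_iUnion.2 ⟨⟨q, by exact_mod_cast h2⟩, frequently_of_locDim_lt h1⟩

end LocalDimension

namespace GapMeasure

/-- The cells of level `k` are the triadic intervals of length `3 ^ (-lev k)`. -/
def lev : ℕ → ℕ
  | 0 => 0
  | k + 1 => (k + 1) * lev k + 1

/-- The number of children of a cell of level `k`. -/
def bas (k : ℕ) : ℕ := 3 ^ (k * lev k + 1)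

/-- Whether the `i`-th cell of level `k` carries a centre at which the local dimension is `2`.
The last child of an ordinary cell and the central child of a special cell are special. -/
def Special : ℕ → ℕ → Prop
  | 0, _ => False
  | k + 1, i => (Special k (i / bas k) ∧ i % bas k = bas k / 2) ∨
      (¬ Special k (i / bas k) ∧ i % bas k = bas k - 1)

/-- The proportion of the mass of a cell with `N` children carried by its first `d` children.
In an ordinary cell half of the mass is uniform and half lies in the first child; in a special
cell a central window of relative length `λ` has relative mass `λ ^ 2`. -/
noncomputable def cum (S : Prop) (N d : ℕ) : ℝ :=
  if S then (1 + ((2 * d - N) / N : ℝ) * |((2 * d - N) / N : ℝ)|) / 2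
  else if d = 0 then 0 else 1 / 2 + d / (2 * N)

/-- The mass of the first `i` cells of level `k`. -/
noncomputable def F : ℕ → ℕ → ℝ
  | 0, i => if i = 0 then 0 else 1
  | k + 1, i => F k (i / bas k) +
      (F k (i / bas k + 1) - F k (i / bas k)) * cum (Special k (i / bas k)) (bas k) (i % bas k)

/-- The mass of the `i`-th cell of level `k`. -/
noncomputable def P (k i : ℕ) : ℝ := F k (i + 1) - F k i

theorem lev_succ (k : ℕ) : lev (k + 1) = (k + 1) * lev k + 1 := rfl

theorem lev_lt_succ (k : ℕ) : lev k < lev (k + 1) := by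
  rw [lev_succ]; nlinarith [Nat.zero_le (k * lev k)]

theorem lev_strictMono : StrictMono lev := strictMono_nat_of_lt_succ lev_lt_succ

theorem le_lev (k : ℕ) : k ≤ lev k := lev_strictMono.le_apply

theorem pow_lev_succ (k : ℕ) : 3 ^ lev (k + 1) = 3 ^ lev k * bas k := by
  rw [bas, ← pow_add, lev_succ]; ring_nf

theorem bas_ge (k : ℕ) : 3 ≤ bas k := by
  rw [bas]; exact Nat.le_self_pow (by omega) 3

theorem bas_pos (k : ℕ) : 0 < bas k := by have := bas_ge k; omega

theorem bas_odd (k : ℕ) : Odd (bas k) := (by decide : Odd 3).pow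

section Cum

variable {S : Prop} {N d : ℕ}

theorem cum_zero (hN : 0 < N) : cum S N 0 = 0 := by
  have : (N : ℝ) ≠ 0 := by positivity
  unfold cum
  split_ifs
  · simp [this]
  · rfl
  · exact absurd rfl ‹¬0 = 0›

theorem cum_self (hN : 0 < N) : cum S N N = 1 := by
  have : (N : ℝ) ≠ 0 := by positivity
  unfold cum
  split_ifs with h1 h2
  · rw [show (2 * N - N : ℝ) = N by ring]; simp [this]
  · omega
  · field_simp; norm_num

theorem cum_special (hS : S) (hN : 0 < N) (d : ℕ) :
    cum S N d = (1 + (2 * d - N) * |(2 * d - N : ℝ)| / N ^ 2) / 2 := by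
  have : (0 : ℝ) < N := by positivity
  rw [cum, if_pos hS, abs_div, abs_of_pos this]
  field_simp

theorem cum_step_ge (hN : 2 ≤ N) (d : ℕ) :
    1 / (N : ℝ) ^ 2 ≤ cum S N (d + 1) - cum S N d := by
  have hN' : (2 : ℝ) ≤ N := by exact_mod_cast hN
  by_cases hS : S
  · rw [cum_special hS (by omega), cum_special hS (by omega)]
    push_cast
    generalize hu : (2 * d - N : ℝ) = u
    rw [show (2 * (d + 1) - N : ℝ) = u + 2 by linarith]
    have key : 2 ≤ (u + 2) * |u + 2| - u * |u| := by
      rcases abs_cases (u + 2) with h | h <;> rcases abs_cases u with h' | h' <;>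
        rw [h.1, h'.1] <;> nlinarith [sq_nonneg (u + 1)]
    rw [show (1 + (u + 2) * |u + 2| / N ^ 2) / 2 - (1 + u * |u| / N ^ 2) / 2 =
      ((u + 2) * |u + 2| - u * |u|) / 2 / (N : ℝ) ^ 2 by ring]
    gcongr
    linarith
  · rw [cum, cum, if_neg hS, if_neg hS, if_neg (by omega)]
    have h2 : 1 / (N : ℝ) ^ 2 ≤ 1 / (2 * N) := by
      apply one_div_le_one_div_of_le <;> nlinarith
    push_cast
    split_ifs with h
    · subst h
      simp only [CharP.cast_eq_zero, zero_add]
      linarith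
    · rw [show (1 / 2 + ((d : ℝ) + 1) / (2 * N) - (1 / 2 + d / (2 * N)) : ℝ) = 1 / (2 * N) by ring]
      exact h2

theorem cum_mono (hN : 2 ≤ N) : Monotone (cum S N) := by
  refine monotone_nat_of_le_succ fun d => ?_
  have := cum_step_ge (S := S) hN d
  have : (0 : ℝ) ≤ 1 / (N : ℝ) ^ 2 := by positivity
  linarith

theorem cum_step_le (hN : 3 ≤ N) (hd : d < N) : cum S N (d + 1) - cum S N d ≤ 2 / 3 := by
  have hN' : (3 : ℝ) ≤ N := by exact_mod_cast hN
  have hd' : (d : ℝ) + 1 ≤ N := by exact_mod_cast hd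
  have hd0 : (0 : ℝ) ≤ d := by positivity
  by_cases hS : S
  · rw [cum_special hS (by omega), cum_special hS (by omega)]
    push_cast
    generalize hu : (2 * d - N : ℝ) = u
    rw [show (2 * (d + 1) - N : ℝ) = u + 2 by linarith]
    have hu1 : -N ≤ u := by linarith
    have hu2 : u + 2 ≤ N := by linarith
    have key : (u + 2) * |u + 2| - u * |u| ≤ 4 * (N - 1) := by
      rcases abs_cases (u + 2) with h | h <;> rcases abs_cases u with h' | h' <;>
        rw [h.1, h'.1] <;> nlinarith
    rw [show (1 + (u + 2) * |u + 2| / N ^ 2) / 2 - (1 + u * |u| / N ^ 2) / 2 =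
      ((u + 2) * |u + 2| - u * |u|) / (2 * (N : ℝ) ^ 2) by ring, div_le_iff₀ (by positivity)]
    nlinarith
  · rw [cum, cum, if_neg hS, if_neg hS, if_neg (by omega)]
    have h2 : 1 / (2 * N : ℝ) ≤ 1 / 6 := by
      apply one_div_le_one_div_of_le <;> linarith
    push_cast
    split_ifs with h
    · subst h
      simp only [CharP.cast_eq_zero, zero_add]
      linarith
    · rw [show (1 / 2 + ((d : ℝ) + 1) / (2 * N) - (1 / 2 + d / (2 * N)) : ℝ) = 1 / (2 * N) by ring]
      linarith

theorem cum_step_ordinary (hS : ¬ S) (d : ℕ) :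
    1 / (2 * N : ℝ) ≤ cum S N (d + 1) - cum S N d := by
  rw [cum, cum, if_neg hS, if_neg hS, if_neg (by omega)]
  push_cast
  split_ifs with h
  · subst h
    simp only [CharP.cast_eq_zero, zero_add]
    linarith
  · exact le_of_eq (by ring)

theorem half_le_cum_one (hS : ¬ S) : 1 / 2 ≤ cum S N 1 := by
  rw [cum, if_neg hS, if_neg one_ne_zero]
  have : (0 : ℝ) ≤ (1 : ℕ) / (2 * N) := by positivity
  linarith

/-- Central windows of a special cell. -/
theorem cum_window (hS : S) (hN : 0 < N) {d d' w : ℕ} (h : 2 * d + w = N) (h' : 2 * d' = N + w) :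
    cum S N d' - cum S N d = ((w : ℝ) / N) ^ 2 := by
  rw [cum_special hS hN, cum_special hS hN]
  have e1 : (2 * d - N : ℝ) = -w := by rw [← h]; push_cast; ring
  have e2 : (2 * d' - N : ℝ) = w := by
    have : (2 * d' : ℝ) = N + w := by exact_mod_cast h'
    linarith
  rw [e1, e2, abs_neg, abs_of_nonneg (by positivity : (0 : ℝ) ≤ w)]
  ring

end Cum

theorem mul_add_div_bas {k d : ℕ} (i : ℕ) (hd : d < bas k) : (i * bas k + d) / bas k = i := by
  rw [mul_comm, Nat.mul_add_div (bas_pos k), Nat.div_eq_of_lt hd, add_zero]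

theorem mul_add_mod_bas {k d : ℕ} (i : ℕ) (hd : d < bas k) : (i * bas k + d) % bas k = d := by
  rw [mul_comm, Nat.mul_add_mod, Nat.mod_eq_of_lt hd]

theorem F_child {k d : ℕ} (i : ℕ) (hd : d ≤ bas k) :
    F (k + 1) (i * bas k + d) = F k i + P k i * cum (Special k i) (bas k) d := by
  rcases hd.lt_or_eq with hd | rfl
  · rw [F, mul_add_div_bas i hd, mul_add_mod_bas i hd, P]
  · rw [show i * bas k + bas k = (i + 1) * bas k + 0 by ring, F,
      mul_add_div_bas _ (bas_pos k), mul_add_mod_bas _ (bas_pos k), cum_zero (bas_pos k),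
      cum_self (bas_pos k), P]
    ring

theorem P_child {k d : ℕ} (i : ℕ) (hd : d < bas k) :
    P (k + 1) (i * bas k + d) =
      P k i * (cum (Special k i) (bas k) (d + 1) - cum (Special k i) (bas k) d) := by
  rw [P, add_assoc, F_child i hd, F_child i hd.le]
  ring

theorem special_child {k d : ℕ} (i : ℕ) (hd : d < bas k) :
    Special (k + 1) (i * bas k + d) ↔
      (Special k i ∧ d = bas k / 2) ∨ (¬ Special k i ∧ d = bas k - 1) := by
  rw [Special, mul_add_div_bas i hd, mul_add_mod_bas i hd]

theorem exists_child (k j : ℕ) : ∃ i d, d < bas k ∧ j = i * bas k + d :=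
  ⟨j / bas k, j % bas k, Nat.mod_lt _ (bas_pos k), (Nat.div_add_mod' j (bas k)).symm⟩

theorem P_nonneg (k j : ℕ) : 0 ≤ P k j := by
  induction k generalizing j with
  | zero => rw [P, F, F, if_neg (Nat.succ_ne_zero j)]; split_ifs <;> norm_num
  | succ k ih =>
    obtain ⟨i, d, hd, rfl⟩ := exists_child k j
    rw [P_child i hd]
    exact mul_nonneg (ih i) (sub_nonneg.2 (cum_mono (by have := bas_ge k; omega) (by omega)))

theorem F_mono (k : ℕ) : Monotone (F k) :=
  monotone_nat_of_le_succ fun i => sub_nonneg.1 (P_nonneg k i)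

theorem F_refine_succ (k i : ℕ) : F (k + 1) (i * bas k) = F k i := by
  have := F_child (k := k) i (Nat.zero_le _)
  rwa [cum_zero (bas_pos k), mul_zero, add_zero, add_zero] at this

theorem F_refine (k j i : ℕ) : F (k + j) (i * 3 ^ (lev (k + j) - lev k)) = F k i := by
  induction j with
  | zero => simp
  | succ j ih =>
    rw [← ih, ← F_refine_succ (k + j), ← add_assoc, bas, mul_assoc, ← pow_add]
    congr 3
    have h1 := lev_strictMono.monotone (show k ≤ k + j by omega)
    rw [lev_succ, add_mul, one_mul]
    omega

theorem F_zero (k : ℕ) : F k 0 = 0 := by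
  have := F_refine 0 k 0
  rw [zero_mul, zero_add] at this
  rw [this, F, if_pos rfl]

theorem F_of_ge {k i : ℕ} (h : 3 ^ lev k ≤ i) : F k i = 1 := by
  induction k generalizing i with
  | zero => rw [F, if_neg]; simp [lev] at h; omega
  | succ k ih =>
    rw [pow_lev_succ] at h
    have h1 : 3 ^ lev k ≤ i / bas k := (Nat.le_div_iff_mul_le (bas_pos k)).2 h
    rw [F, ih h1, ih (h1.trans (Nat.le_succ _))]
    ring

theorem F_nonneg (k i : ℕ) : 0 ≤ F k i := F_zero k ▸ F_mono k (Nat.zero_le i)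

theorem F_le_one (k i : ℕ) : F k i ≤ 1 :=
  (F_mono k (le_max_left i (3 ^ lev k))).trans (F_of_ge (le_max_right _ _)).le

theorem P_le (k j : ℕ) : P k j ≤ (2 / 3) ^ k := by
  induction k generalizing j with
  | zero =>
    rw [P, pow_zero]
    linarith [F_le_one 0 (j + 1), F_nonneg 0 j]
  | succ k ih =>
    obtain ⟨i, d, hd, rfl⟩ := exists_child k j
    rw [P_child i hd, pow_succ]
    exact mul_le_mul (ih i) (cum_step_le (bas_ge k) hd)
      (sub_nonneg.2 (cum_mono (by have := bas_ge k; omega) (by omega))) (by positivity)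

theorem pow_lev_succ_cast (k : ℕ) : (3 : ℝ) ^ lev (k + 1) = 3 ^ lev k * bas k := by
  exact_mod_cast pow_lev_succ k

theorem P_ge {k j : ℕ} (hj : j < 3 ^ lev k) : 1 / ((3 : ℝ) ^ lev k) ^ 2 ≤ P k j := by
  induction k generalizing j with
  | zero =>
    obtain rfl : j = 0 := by simpa [lev] using hj
    simp [P, F, lev]
  | succ k ih =>
    obtain ⟨i, d, hd, rfl⟩ := exists_child k j
    have hi : i < 3 ^ lev k := by
      rw [pow_lev_succ] at hj
      by_contra! h
      have := Nat.mul_le_mul_right (bas k) h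
      omega
    rw [P_child i hd, pow_lev_succ_cast, mul_pow, ← one_div_mul_one_div]
    exact mul_le_mul (ih hi) (cum_step_ge (by have := bas_ge k; omega) d) (by positivity)
      (P_nonneg k i)

/-- The distribution function of the measure, up to right limits. -/
noncomputable def G (x : ℝ) : ℝ := ⨆ k, F k ⌊x * 3 ^ lev k⌋₊

theorem bddAbove_F (x : ℝ) : BddAbove (range fun k => F k ⌊x * 3 ^ lev k⌋₊) :=
  ⟨1, by rintro _ ⟨k, rfl⟩; exact F_le_one _ _⟩

theorem G_mono : Monotone G := by
  intro x y hxy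
  refine ciSup_mono (bddAbove_F y) fun k => F_mono k (Nat.floor_mono ?_)
  gcongr

theorem G_grid (k i : ℕ) : G (i / 3 ^ lev k) = F k i := by
  have hk : (3 : ℝ) ^ lev k ≠ 0 := by positivity
  refine le_antisymm (ciSup_le fun k' => ?_) ?_
  · rcases le_total k k' with h | h
    · obtain ⟨j, rfl⟩ := Nat.exists_eq_add_of_le h
      have : (i : ℝ) / 3 ^ lev k * 3 ^ lev (k + j) =
          ((i * 3 ^ (lev (k + j) - lev k) : ℕ) : ℝ) := by
        push_cast
        rw [pow_sub₀ _ (by norm_num) (lev_strictMono.monotone h)]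
        field_simp
      rw [this, Nat.floor_natCast, F_refine]
    · obtain ⟨j, rfl⟩ := Nat.exists_eq_add_of_le h
      rw [← F_refine k' j]
      apply F_mono
      have h1 := Nat.floor_le (show (0 : ℝ) ≤ (i : ℝ) / 3 ^ lev (k' + j) * 3 ^ lev k' by positivity)
      have h2 : ((⌊(i : ℝ) / 3 ^ lev (k' + j) * 3 ^ lev k'⌋₊ * 3 ^ (lev (k' + j) - lev k') : ℕ) : ℝ)
          ≤ i := by
        push_cast
        calc _ ≤ (i : ℝ) / 3 ^ lev (k' + j) * 3 ^ lev k' * 3 ^ (lev (k' + j) - lev k') := by gcongr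
          _ = i := by
            rw [pow_sub₀ _ (by norm_num) (lev_strictMono.monotone h)]
            field_simp
      exact_mod_cast h2
  · refine le_ciSup_of_le (bddAbove_F _) k ?_
    rw [div_mul_cancel₀ _ hk, Nat.floor_natCast]

theorem tendsto_two_thirds : Tendsto (fun k : ℕ => ((2 : ℝ) / 3) ^ k) atTop (𝓝 0) :=
  tendsto_pow_atTop_nhds_zero_of_lt_one (by norm_num) (by norm_num)

theorem stieltjes_grid (k i : ℕ) : G_mono.stieltjesFunction (i / 3 ^ lev k : ℝ) = F k i := by
  rw [Monotone.stieltjesFunction_eq]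
  refine le_antisymm ?_ (G_grid k i ▸ G_mono.le_rightLim le_rfl)
  have key : ∀ j, Function.rightLim G (i / 3 ^ lev k : ℝ) ≤ F k i + (2 / 3) ^ j := by
    intro j
    set i' := i * 3 ^ (lev (k + j) - lev k) with hi'
    have e : (i : ℝ) / 3 ^ lev k = (i' : ℝ) / 3 ^ lev (k + j) := by
      rw [hi']
      push_cast
      rw [pow_sub₀ _ (by norm_num) (lev_strictMono.monotone (Nat.le_add_right k j))]
      field_simp
    have h1 : Function.rightLim G (i / 3 ^ lev k : ℝ) ≤
        G (((i' + 1 : ℕ) : ℝ) / 3 ^ lev (k + j)) := by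
      apply G_mono.rightLim_le
      rw [e]
      push_cast
      gcongr
      linarith
    have h2 := P_le (k + j) i'
    rw [P, hi', F_refine, ← hi'] at h2
    rw [G_grid] at h1
    have h3 : ((2 : ℝ) / 3) ^ (k + j) ≤ (2 / 3) ^ j :=
      pow_le_pow_of_le_one (by norm_num) (by norm_num) (Nat.le_add_left j k)
    linarith
  have := tendsto_two_thirds.const_add (F k i)
  rw [add_zero] at this
  exact ge_of_tendsto' this key

/-- The measure of the theorem. -/
noncomputable def gapMeasure : Measure ℝ := G_mono.stieltjesFunction.measure

theorem stieltjes_of_nonpos {x : ℝ} (hx : x ≤ 0) : G_mono.stieltjesFunction x = 0 := by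
  have h0 : G_mono.stieltjesFunction 0 = 0 := by
    have := stieltjes_grid 0 0
    rwa [F_zero, Nat.cast_zero, zero_div] at this
  refine le_antisymm (h0 ▸ G_mono.stieltjesFunction.mono hx) ?_
  rw [Monotone.stieltjesFunction_eq]
  refine le_trans ?_ (G_mono.le_rightLim le_rfl)
  exact le_ciSup_of_le (bddAbove_F _) 0 (F_nonneg _ _)

theorem stieltjes_of_one_le {x : ℝ} (hx : 1 ≤ x) : G_mono.stieltjesFunction x = 1 := by
  have h0 : G_mono.stieltjesFunction 1 = 1 := by
    have := stieltjes_grid 0 1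
    rwa [Nat.cast_one, lev, pow_zero, div_one, F, if_neg one_ne_zero] at this
  refine le_antisymm ?_ (h0 ▸ G_mono.stieltjesFunction.mono hx)
  rw [Monotone.stieltjesFunction_eq]
  exact (G_mono.rightLim_le (lt_add_one x)).trans (ciSup_le fun k => F_le_one _ _)

theorem gapMeasure_univ : gapMeasure univ = 1 := by
  rw [gapMeasure, StieltjesFunction.measure_univ (l := 0) (u := 1)]
  · simp
  · refine tendsto_const_nhds.congr' ?_
    filter_upwards [eventually_le_atBot (0 : ℝ)] with x hx using (stieltjes_of_nonpos hx).symm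
  · refine tendsto_const_nhds.congr' ?_
    filter_upwards [eventually_ge_atTop (1 : ℝ)] with x hx using (stieltjes_of_one_le hx).symm

instance : IsProbabilityMeasure gapMeasure := ⟨gapMeasure_univ⟩

theorem gapMeasure_real_Ioc {k i j : ℕ} (hij : i ≤ j) :
    gapMeasure.real (Ioc (i / 3 ^ lev k : ℝ) (j / 3 ^ lev k)) = F k j - F k i := by
  rw [Measure.real, gapMeasure, StieltjesFunction.measure_Ioc, stieltjes_grid, stieltjes_grid,
    ENNReal.toReal_ofReal (sub_nonneg.2 (F_mono k hij))]

theorem gapMeasure_compl_Ioc : gapMeasure (Ioc (0 : ℝ) 1)ᶜ = 0 := by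
  rw [prob_compl_eq_zero_iff measurableSet_Ioc, gapMeasure, StieltjesFunction.measure_Ioc,
    stieltjes_of_nonpos le_rfl, stieltjes_of_one_le le_rfl]
  simp

theorem gapMeasure_compl_Icc : gapMeasure (Icc (0 : ℝ) 1)ᶜ = 0 :=
  measure_mono_null (compl_subset_compl.2 Ioc_subset_Icc_self) gapMeasure_compl_Ioc

/-- The index of the cell of level `k` containing `x`; cells are closed on the right. -/
noncomputable def addr (x : ℝ) (k : ℕ) : ℕ := ⌈x * 3 ^ lev k⌉₊ - 1

theorem addr_lt {x : ℝ} (hx : 0 < x) (k : ℕ) : (addr x k : ℝ) < x * 3 ^ lev k := by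
  have : 0 < ⌈x * 3 ^ lev k⌉₊ := Nat.ceil_pos.2 (by positivity)
  exact Nat.lt_ceil.1 (by rw [addr]; omega)

theorem le_addr (x : ℝ) (k : ℕ) : x * 3 ^ lev k ≤ (addr x k : ℝ) + 1 := by
  refine (Nat.le_ceil _).trans ?_
  rw [addr]
  exact_mod_cast (by omega : ⌈x * 3 ^ lev k⌉₊ ≤ ⌈x * 3 ^ lev k⌉₊ - 1 + 1)

theorem addr_le {x : ℝ} (hx : 0 ≤ x) (k : ℕ) : (addr x k : ℝ) ≤ x * 3 ^ lev k := by
  rcases hx.eq_or_lt with rfl | hx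
  · simp [addr]
  · exact (addr_lt hx k).le

theorem addr_lt_pow {x : ℝ} (hx : x ≤ 1) (k : ℕ) : addr x k < 3 ^ lev k := by
  have h1 : ⌈x * 3 ^ lev k⌉₊ ≤ 3 ^ lev k := by
    refine Nat.ceil_le.2 ?_
    push_cast
    exact mul_le_of_le_one_left (by positivity) hx
  have h2 : 0 < 3 ^ lev k := by positivity
  rw [addr]
  omega

theorem addr_succ_div {x : ℝ} (hx : 0 ≤ x) (k : ℕ) : addr x (k + 1) / bas k = addr x k := by
  rcases hx.eq_or_lt with rfl | hx
  · simp [addr]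
  have h1 := addr_lt hx k
  have h2 := le_addr x k
  have h3 := addr_lt hx (k + 1)
  have h4 := le_addr x (k + 1)
  have hb : (0 : ℝ) < bas k := by exact_mod_cast bas_pos k
  rw [pow_lev_succ_cast, ← mul_assoc] at h3 h4
  have h5 : addr x k * bas k < addr x (k + 1) + 1 := by
    have : (addr x k : ℝ) * bas k < addr x (k + 1) + 1 :=
      ((mul_lt_mul_iff_of_pos_right hb).2 h1).trans_le h4
    exact_mod_cast this
  have h6 : addr x (k + 1) < (addr x k + 1) * bas k := by
    have : (addr x (k + 1) : ℝ) < (addr x k + 1) * bas k :=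
      h3.trans_le ((mul_le_mul_iff_of_pos_right hb).2 h2)
    exact_mod_cast this
  exact Nat.div_eq_of_lt_le (by omega) h6

theorem gapMeasure_singleton (x : ℝ) : gapMeasure {x} = 0 := by
  rcases le_or_gt x 0 with hx | hx
  · exact measure_mono_null (singleton_subset_iff.2 fun h => h.1.not_ge hx) gapMeasure_compl_Ioc
  rw [← measureReal_eq_zero_iff]
  refine le_antisymm (ge_of_tendsto' tendsto_two_thirds fun k => ?_) measureReal_nonneg
  have := gapMeasure_real_Ioc (k := k) (Nat.le_succ (addr x k))
  refine le_trans ?_ (P_le k (addr x k))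
  rw [P, ← this]
  refine measureReal_mono (singleton_subset_iff.2 ⟨?_, ?_⟩)
  · rw [div_lt_iff₀ (by positivity)]
    exact addr_lt hx k
  · rw [le_div_iff₀ (by positivity)]
    exact_mod_cast le_addr x k

/-- The centre of the `i`-th cell of level `k`. -/
noncomputable def cen (k i : ℕ) : ℝ := (2 * i + 1) / (2 * 3 ^ lev k)

theorem two_mul_bas_div_two (k : ℕ) : 2 * (bas k / 2) + 1 = bas k :=
  Nat.two_mul_div_two_add_one_of_odd (bas_odd k)

theorem special_central {k i : ℕ} (h : Special k i) :
    Special (k + 1) (i * bas k + bas k / 2) := by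
  have := two_mul_bas_div_two k
  have := bas_ge k
  exact (special_child i (by omega)).2 (Or.inl ⟨h, rfl⟩)

theorem cen_central (k i : ℕ) : cen (k + 1) (i * bas k + bas k / 2) = cen k i := by
  have h : (2 * ((bas k / 2 : ℕ) : ℝ) + 1) = bas k := by exact_mod_cast two_mul_bas_div_two k
  have hb : (0 : ℝ) < bas k := by exact_mod_cast bas_pos k
  rw [cen, cen, pow_lev_succ_cast]
  push_cast
  rw [show (2 * ((i : ℝ) * bas k + ((bas k / 2 : ℕ) : ℝ)) + 1) = (2 * i + 1) * bas k by
    linear_combination h]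
  field_simp

theorem P_central {k i : ℕ} (h : Special k i) :
    P (k + 1) (i * bas k + bas k / 2) * (3 ^ lev (k + 1)) ^ 2 = P k i * (3 ^ lev k) ^ 2 := by
  have h1 := two_mul_bas_div_two k
  have hb : (0 : ℝ) < bas k := by exact_mod_cast bas_pos k
  rw [P_child i (by omega), cum_window h (bas_pos k) (w := 1) h1 (by omega), pow_lev_succ_cast]
  push_cast
  field_simp

theorem gapMeasure_window_of_le {k i q : ℕ} (h : Special k i) (hq : lev k ≤ q)
    (hq' : q ≤ lev (k + 1)) :
    gapMeasure.real (Ioc (cen k i - 1 / (2 * 3 ^ q)) (cen k i + 1 / (2 * 3 ^ q))) =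
      P k i * (3 ^ lev k) ^ 2 / (3 ^ q) ^ 2 := by
  obtain ⟨w, hw⟩ : ∃ w, w = 3 ^ (lev (k + 1) - q) := ⟨_, rfl⟩
  have hwo : Odd w := hw ▸ (by decide : Odd 3).pow
  have hNo := bas_odd k
  have hbw : 3 ^ (q - lev k) * w = bas k := by
    have := pow_lev_succ k
    have h2 : 3 ^ lev k * (3 ^ (q - lev k) * w) = 3 ^ lev k * bas k := by
      rw [← this, hw, ← pow_add, ← pow_add]; congr 1; omega
    exact Nat.eq_of_mul_eq_mul_left (by positivity) h2
  have hwN : w ≤ bas k := by rw [← hbw]; exact Nat.le_mul_of_pos_left _ (by positivity)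
  obtain ⟨d, hd⟩ : ∃ d, 2 * d + w = bas k := by
    obtain ⟨a, ha⟩ := hwo; obtain ⟨b, hb⟩ := hNo; exact ⟨b - a, by omega⟩
  have hb : (0 : ℝ) < bas k := by exact_mod_cast bas_pos k
  have hdr : (2 * d + w : ℝ) = bas k := by exact_mod_cast hd
  have hwq : (w : ℝ) * 3 ^ q = 3 ^ lev k * bas k := by
    rw [← pow_lev_succ_cast, hw]; push_cast; rw [← pow_add]; congr 1; omega
  have e1 : cen k i - 1 / (2 * 3 ^ q) = ((i * bas k + d : ℕ) : ℝ) / 3 ^ lev (k + 1) := by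
    rw [cen, pow_lev_succ_cast, ← hwq, div_sub_div _ _ (by positivity) (by positivity),
      div_eq_div_iff (by positivity) (by rw [hwq]; positivity)]
    push_cast
    linear_combination (4 * (i : ℝ) * 3 ^ q + 2 * 3 ^ q) * hwq - 2 * 3 ^ q * 3 ^ lev k * hdr
  have e2 : cen k i + 1 / (2 * 3 ^ q) = ((i * bas k + (d + w) : ℕ) : ℝ) / 3 ^ lev (k + 1) := by
    rw [cen, pow_lev_succ_cast, ← hwq, div_add_div _ _ (by positivity) (by positivity),
      div_eq_div_iff (by positivity) (by rw [hwq]; positivity)]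
    push_cast
    linear_combination (4 * (i : ℝ) * 3 ^ q + 2 * 3 ^ q) * hwq - 2 * 3 ^ q * 3 ^ lev k * hdr
  rw [e1, e2, gapMeasure_real_Ioc (by omega), F_child i (by omega), F_child i (by omega),
    add_sub_add_left_eq_sub, ← mul_sub, cum_window h (bas_pos k) hd (by omega),
    (by rw [div_eq_div_iff hb.ne' (by positivity)]; exact hwq :
      (w : ℝ) / bas k = 3 ^ lev k / 3 ^ q)]
  ring

theorem gapMeasure_window {k i q : ℕ} (h : Special k i) (hq : lev k ≤ q) :
    gapMeasure.real (Ioc (cen k i - 1 / (2 * 3 ^ q)) (cen k i + 1 / (2 * 3 ^ q))) =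
      P k i * (3 ^ lev k) ^ 2 / (3 ^ q) ^ 2 := by
  obtain ⟨m, hm⟩ : ∃ m, q < lev (k + m) := ⟨q + 1, by have := le_lev (k + (q + 1)); omega⟩
  induction m generalizing k i with
  | zero => rw [add_zero] at hm; omega
  | succ m ih =>
    rcases le_total q (lev (k + 1)) with h1 | h1
    · exact gapMeasure_window_of_le h hq h1
    · have := ih (special_central h) h1 (by rwa [add_right_comm])
      rwa [cen_central, P_central h] at this

theorem eventually_rpow_lt {a B : ℝ} (ha : 0 < a) (hB : 0 < B) :
    ∀ᶠ r : ℝ in 𝓝[>] 0, r ^ a < B := by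
  have : Tendsto (fun r : ℝ => r ^ a) (𝓝[>] 0) (𝓝 0) := by
    have h := (Real.continuousAt_rpow_const 0 a (Or.inr ha.le)).tendsto
    rw [Real.zero_rpow ha.ne'] at h
    exact h.mono_left nhdsWithin_le_nhds
  exact this.eventually_lt_const hB

theorem gapMeasure_ball_cen {k i : ℕ} (h : Special k i) :
    ∀ᶠ r : ℝ in 𝓝[>] 0,
      P k i * (3 ^ lev k) ^ 2 / 9 * r ^ 2 ≤ gapMeasure.real (ball (cen k i) r) ∧
      gapMeasure.real (ball (cen k i) r) ≤ P k i * (3 ^ lev k) ^ 2 * 36 * r ^ 2 := by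
  set A := P k i * (3 ^ lev k) ^ 2 with hA
  have hA0 : 0 ≤ A := mul_nonneg (P_nonneg k i) (by positivity)
  filter_upwards [eventually_mem_Ioo_zero (δ := (1 / 3) ^ lev k / 2) (by positivity)] with r hr
  obtain ⟨hr0, hr1⟩ := hr
  obtain ⟨q, hq1, hq2⟩ := exists_nat_pow_near_of_lt_one (x := 2 * r) (y := 1 / 3) (by positivity)
    ((by linarith : 2 * r ≤ (1 / 3 : ℝ) ^ lev k).trans
      (pow_le_one₀ (by norm_num) (by norm_num))) (by norm_num) (by norm_num)
  have hlq : lev k < q + 1 := by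
    by_contra! hcon
    have := pow_le_pow_of_le_one (a := (1 / 3 : ℝ)) (by norm_num) (by norm_num) hcon
    linarith
  have e : ∀ q : ℕ, (1 : ℝ) / (2 * 3 ^ q) = (1 / 3) ^ q / 2 := fun q => by
    rw [one_div_pow]; field_simp
  have f : ∀ q : ℕ, A / ((3 : ℝ) ^ q) ^ 2 = A * ((1 / 3) ^ q) ^ 2 := fun q => by
    rw [one_div_pow, one_div_pow]; field_simp
  have w1 := gapMeasure_window h (q := q) (by omega)
  have w2 := gapMeasure_window h (q := q + 1) (by omega)
  rw [e, ← hA, f] at w1 w2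
  rw [Real.ball_eq_Ioo]
  constructor
  · calc A / 9 * r ^ 2 ≤ A * ((1 / 3) ^ (q + 1)) ^ 2 := by
          rw [div_mul_eq_mul_div, mul_div_assoc]
          gcongr
          have : r / 3 ≤ (1 / 3 : ℝ) ^ (q + 1) := by
            rw [pow_succ]; linarith
          calc r ^ 2 / 9 = (r / 3) ^ 2 := by ring
            _ ≤ _ := by gcongr
      _ = _ := w2.symm
      _ ≤ gapMeasure.real (Ioo (cen k i - r) (cen k i + r)) :=
          measureReal_mono fun y hy => ⟨by linarith [hy.1], by linarith [hy.2]⟩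
  · calc gapMeasure.real (Ioo (cen k i - r) (cen k i + r))
        ≤ gapMeasure.real (Ioc (cen k i - (1 / 3) ^ q / 2) (cen k i + (1 / 3) ^ q / 2)) :=
          measureReal_mono fun y hy => ⟨by linarith [hy.1], by linarith [hy.2]⟩
      _ = A * ((1 / 3) ^ q) ^ 2 := w1
      _ ≤ A * (6 * r) ^ 2 := by
          rw [pow_succ] at hq1
          gcongr
          linarith
      _ = _ := by ring

theorem locDim_cen {k i : ℕ} (h : Special k i) (hi : i < 3 ^ lev k) :
    locDim gapMeasure (cen k i) = ((2 : ℝ) : EReal) := by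
  have hA : 0 < P k i * (3 ^ lev k) ^ 2 :=
    mul_pos (lt_of_lt_of_le (by positivity) (P_ge hi)) (by positivity)
  have hpow : ∀ {r : ℝ} (t : ℝ), 0 < r → r ^ t = r ^ (t - 2) * r ^ 2 := fun {r} t hr => by
    rw [← Real.rpow_natCast, ← Real.rpow_add hr]; norm_num
  refine le_antisymm (locDim_le_of_frequently fun t ht => Eventually.frequently ?_)
    (le_locDim_of_eventually fun t ht => ?_)
  · filter_upwards [gapMeasure_ball_cen h, eventually_mem_Ioo_zero one_pos,
      eventually_rpow_lt (a := t - 2) (by linarith) (by positivity :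
        0 < P k i * (3 ^ lev k) ^ 2 / 9)] with r h1 h2 h3
    rw [hpow t h2.1]
    refine le_trans ?_ h1.1
    gcongr
  · filter_upwards [gapMeasure_ball_cen h, eventually_mem_Ioo_zero one_pos,
      eventually_rpow_lt (a := 2 - t) (B := 1 / (P k i * (3 ^ lev k) ^ 2 * 36)) (by linarith)
        (by positivity)] with r h1 h2 h3
    refine h1.2.trans_lt ?_
    rw [hpow t h2.1, ← neg_sub, Real.rpow_neg h2.1.le]
    have h4 : 0 < r ^ (2 - t) := Real.rpow_pos_of_pos h2.1 _
    have := h2.1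
    gcongr
    rwa [lt_inv_comm₀ (by positivity) h4, ← one_div]

/-- The centres of the special cells. -/
def centres : Set ℝ := {x | ∃ k i, Special k i ∧ i < 3 ^ lev k ∧ x = cen k i}

theorem countable_centres : centres.Countable := by
  refine (countable_range fun p : ℕ × ℕ => cen p.1 p.2).mono ?_
  rintro _ ⟨k, i, -, -, rfl⟩
  exact ⟨(k, i), rfl⟩

theorem tendsto_pow_lev : Tendsto (fun k => ((1 : ℝ) / 3) ^ lev k) atTop (𝓝 0) :=
  (tendsto_pow_atTop_nhds_zero_of_lt_one (by norm_num) (by norm_num)).comp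
    lev_strictMono.tendsto_atTop

theorem frequently_not_special {x : ℝ} (hx : x ∈ Icc (0 : ℝ) 1) (hxc : x ∉ centres) :
    ∃ᶠ k in atTop, ¬ Special k (addr x k) := by
  intro hcon
  obtain ⟨K, hK⟩ := eventually_atTop.1 hcon
  simp only [not_not] at hK
  have hcen : ∀ j, cen (K + j) (addr x (K + j)) = cen K (addr x K) := by
    intro j
    induction j with
    | zero => rfl
    | succ j ih =>
      have h1 : Special (K + j + 1) (addr x (K + j + 1)) := hK (K + j + 1) (by omega)
      rw [Special, addr_succ_div hx.1] at h1
      have h2 : addr x (K + j + 1) % bas (K + j) = bas (K + j) / 2 := by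
        have := hK (K + j) (by omega)
        tauto
      have h3 : addr x (K + j) * bas (K + j) + bas (K + j) / 2 = addr x (K + j + 1) := by
        rw [← h2, ← addr_succ_div hx.1 (K + j)]
        exact Nat.div_add_mod' _ _
      rw [← ih, ← cen_central (K + j), h3]
      rfl
  have hdist : ∀ j, |x - cen K (addr x K)| ≤ ((1 : ℝ) / 3) ^ lev (K + j) := by
    intro j
    rw [← hcen j]
    have h1 := addr_le hx.1 (K + j)
    have h2 := le_addr x (K + j)
    have hp : (0 : ℝ) < 3 ^ lev (K + j) := by positivity
    have h3 : ((1 : ℝ) / 3) ^ lev (K + j) * 3 ^ lev (K + j) = 1 := by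
      rw [← mul_pow]; norm_num
    have h4 : cen (K + j) (addr x (K + j)) * 3 ^ lev (K + j) = addr x (K + j) + 1 / 2 := by
      rw [cen]; field_simp
    rw [abs_le]
    constructor <;> nlinarith
  have : |x - cen K (addr x K)| ≤ 0 :=
    ge_of_tendsto' (tendsto_pow_lev.comp (tendsto_add_atTop_nat K)) fun j => by
      rw [Function.comp, add_comm]; exact hdist j
  refine hxc ⟨K, addr x K, hK K le_rfl, addr_lt_pow hx.2 K, ?_⟩
  have := abs_nonpos_iff.1 this
  linarith

/-- A triadic form of the criterion bounding the local dimension from above. -/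
theorem locDim_le_of_exponents {μ : Measure ℝ} {x s : ℝ} (hs : 0 ≤ s) {E : ℕ → ℕ}
    (hE : Tendsto E atTop atTop)
    (h : ∀ t > s, ∃ᶠ k in atTop, ∃ u : ℝ, (3 : ℝ) ^ (-u) ≤ μ.real (ball x (2 / 3 ^ E k)) ∧
      u + t ≤ t * E k) : locDim μ x ≤ (s : EReal) := by
  refine locDim_le_of_seq (r := fun k => 2 / 3 ^ E k) (fun k => by positivity) ?_ fun t ht => ?_
  · have h1 : Tendsto (fun k => 2 * ((1 : ℝ) / 3) ^ E k) atTop (𝓝 (2 * 0)) :=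
      ((tendsto_pow_atTop_nhds_zero_of_lt_one (by norm_num) (by norm_num)).comp hE).const_mul 2
    rw [mul_zero] at h1
    refine h1.congr fun k => ?_
    rw [one_div_pow]; ring
  · refine (h t ht).mono ?_
    rintro k ⟨u, h1, h2⟩
    refine le_trans ?_ h1
    have h3 : (2 : ℝ) / 3 ^ E k ≤ 3 ^ (1 - E k : ℝ) := by
      rw [Real.rpow_sub (by norm_num), Real.rpow_one, Real.rpow_natCast]
      gcongr
      norm_num
    calc (2 / 3 ^ E k : ℝ) ^ t ≤ ((3 : ℝ) ^ (1 - E k : ℝ)) ^ t :=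
          Real.rpow_le_rpow (by positivity) h3 (by linarith)
      _ = (3 : ℝ) ^ ((1 - E k) * t : ℝ) := by rw [← Real.rpow_mul (by norm_num)]
      _ ≤ (3 : ℝ) ^ (-u) := Real.rpow_le_rpow_of_exponent_le (by norm_num) (by linarith)

theorem eventually_lev_le {τ : ℝ} (hτ : 0 < τ) (C : ℝ) :
    ∀ᶠ k in atTop, C * lev k + C ≤ τ * lev (k + 1) := by
  obtain ⟨K, hK⟩ := exists_nat_gt (2 * |C| / τ)
  filter_upwards [eventually_ge_atTop (K + 1)] with k hk
  have h1 : 2 * |C| < K * τ := (div_lt_iff₀ hτ).1 hK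
  have h2 : (1 : ℝ) ≤ lev k := by exact_mod_cast (by have := le_lev k; omega : 1 ≤ lev k)
  have h3 : (K : ℝ) * lev k ≤ lev (k + 1) := by
    rw [lev_succ]
    exact_mod_cast (by nlinarith : K * lev k ≤ (k + 1) * lev k + 1)
  have h4 := le_abs_self C
  have h5 := abs_nonneg C
  calc C * lev k + C ≤ |C| * lev k + |C| * lev k := by nlinarith
    _ = 2 * |C| * lev k := by ring
    _ ≤ K * τ * lev k := by gcongr
    _ = τ * (K * lev k) := by ring
    _ ≤ τ * lev (k + 1) := by gcongr

theorem three_rpow_neg_natCast (n : ℕ) : (3 : ℝ) ^ (-(n : ℝ)) = 1 / 3 ^ n := by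
  rw [Real.rpow_neg (by norm_num), Real.rpow_natCast, one_div]

theorem mem_ball_of_abs_le {x y p : ℝ} (hp : 0 < p) (h : |y * p - x * p| ≤ 1) :
    y ∈ ball x (2 / p) := by
  rw [mem_ball, Real.dist_eq, lt_div_iff₀ hp]
  rw [← sub_mul, abs_mul, abs_of_pos hp] at h
  linarith

theorem locDim_le_one {x : ℝ} (hx : x ∈ Icc (0 : ℝ) 1) (hxc : x ∉ centres) :
    locDim gapMeasure x ≤ ((1 : ℝ) : EReal) := by
  refine locDim_le_of_exponents zero_le_one (E := fun k => lev (k + 1))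
    (lev_strictMono.tendsto_atTop.comp (tendsto_add_atTop_nat 1)) fun t ht => ?_
  refine ((frequently_not_special hx hxc).and_eventually
    (eventually_lev_le (τ := t - 1) (by linarith) (t + 1))).mono ?_
  rintro k ⟨h1, h2⟩
  refine ⟨(1 + lev k + lev (k + 1) : ℕ), ?_, ?_⟩
  · rw [three_rpow_neg_natCast]
    have hb : (0 : ℝ) < bas k := by exact_mod_cast bas_pos k
    have hP := P_ge (addr_lt_pow hx.2 k)
    have hchild : P k (addr x k) * (1 / (2 * bas k)) ≤ P (k + 1) (addr x (k + 1)) := by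
      rw [← Nat.div_add_mod' (addr x (k + 1)) (bas k), addr_succ_div hx.1,
        P_child _ (Nat.mod_lt _ (bas_pos k))]
      gcongr
      · exact P_nonneg _ _
      · exact cum_step_ordinary h1 _
    calc (1 : ℝ) / 3 ^ (1 + lev k + lev (k + 1)) ≤ 1 / (3 ^ lev k) ^ 2 * (1 / (2 * bas k)) := by
          rw [one_div_mul_one_div, pow_add, pow_lev_succ_cast, pow_add]
          apply one_div_le_one_div_of_le (by positivity)
          nlinarith [show 0 < ((3 : ℝ) ^ lev k) ^ 2 * bas k by positivity]
      _ ≤ P k (addr x k) * (1 / (2 * bas k)) := by gcongr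
      _ ≤ _ := hchild
      _ = _ := (gapMeasure_real_Ioc (k := k + 1) (Nat.le_succ (addr x (k + 1)))).symm
      _ ≤ _ := by
        refine measureReal_mono fun y hy => ?_
        have g1 := addr_le hx.1 (k + 1)
        have g2 := le_addr x (k + 1)
        have hp : (0 : ℝ) < 3 ^ lev (k + 1) := by positivity
        obtain ⟨g3, g4⟩ := hy
        rw [div_lt_iff₀ hp] at g3
        rw [le_div_iff₀ hp] at g4
        push_cast at g4
        exact mem_ball_of_abs_le hp (abs_le.2 ⟨by linarith, by linarith⟩)
  · push_cast
    have : (0 : ℝ) ≤ lev k := by positivity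
    nlinarith

/-- A sequence of nested ordinary cells, starting from level `k₀`. -/
structure IsChain (k₀ : ℕ) (i : ℕ → ℕ) : Prop where
  lt_pow : i k₀ < 3 ^ lev k₀
  ordinary : ¬ Special k₀ (i k₀)
  step : ∀ k ≥ k₀, ∃ d, d + 1 < bas k ∧ i (k + 1) = i k * bas k + d

namespace IsChain

variable {k₀ : ℕ} {i : ℕ → ℕ}

theorem not_special (h : IsChain k₀ i) {k : ℕ} (hk : k₀ ≤ k) : ¬ Special k (i k) := by
  induction k, hk using Nat.le_induction with
  | base => exact h.ordinary
  | succ k hk ih =>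
    obtain ⟨d, hd, he⟩ := h.step k hk
    rw [he, special_child _ (by omega)]
    rintro (⟨h1, -⟩ | ⟨-, h1⟩)
    · exact ih h1
    · omega

theorem P_ge (h : IsChain k₀ i) {k : ℕ} (hk : k₀ ≤ k) :
    (1 : ℝ) / 3 ^ (k + lev k + lev k₀) ≤ P k (i k) := by
  induction k, hk using Nat.le_induction with
  | base =>
    refine le_trans (one_div_le_one_div_of_le (by positivity) ?_) (GapMeasure.P_ge h.lt_pow)
    rw [← pow_mul]
    exact pow_le_pow_right₀ (by norm_num) (by omega)
  | succ k hk ih =>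
    obtain ⟨d, hd, he⟩ := h.step k hk
    have hb : (0 : ℝ) < bas k := by exact_mod_cast bas_pos k
    rw [he, P_child _ (by omega)]
    calc (1 : ℝ) / 3 ^ (k + 1 + lev (k + 1) + lev k₀)
        ≤ 1 / 3 ^ (k + lev k + lev k₀) * (1 / (2 * bas k)) := by
          rw [one_div_mul_one_div]
          apply one_div_le_one_div_of_le (by positivity)
          rw [pow_add, pow_add, pow_add _ (k + 1 + lev (k + 1)), pow_add _ (k + 1),
            pow_lev_succ_cast, pow_succ]
          nlinarith [show 0 < (3 : ℝ) ^ k * 3 ^ lev k * 3 ^ lev k₀ * bas k by positivity]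
      _ ≤ _ := mul_le_mul ih (cum_step_ordinary (h.not_special hk) d) (by positivity)
          (P_nonneg _ _)

theorem locDim_le (h : IsChain k₀ i) {x s : ℝ} (hs : 0 ≤ s) {E : ℕ → ℕ} (hE : Tendsto E atTop atTop)
    (hElev : ∀ k ≥ k₀, E k ≤ lev (k + 1))
    (hx : ∀ k ≥ k₀, (i k : ℝ) / 3 ^ lev k ≤ x ∧ x ≤ i k / 3 ^ lev k + 1 / 3 ^ E k)
    (ht : ∀ t > s, ∀ᶠ k in atTop, (k + 1 + lev k + lev k₀ : ℝ) + t ≤ t * E k) :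
    locDim gapMeasure x ≤ (s : EReal) := by
  refine locDim_le_of_exponents hs hE fun t hts => Eventually.frequently ?_
  filter_upwards [ht t hts, eventually_ge_atTop k₀] with k h1 hk
  refine ⟨(k + 1 + lev k + lev k₀ : ℕ), ?_, by push_cast; exact h1⟩
  have hb : (0 : ℝ) < bas k := by exact_mod_cast bas_pos k
  rw [three_rpow_neg_natCast]
  calc (1 : ℝ) / 3 ^ (k + 1 + lev k + lev k₀) ≤ 1 / 3 ^ (k + lev k + lev k₀) * (1 / 2) := by
        rw [one_div_mul_one_div]
        apply one_div_le_one_div_of_le (by positivity)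
        rw [show k + 1 + lev k + lev k₀ = k + lev k + lev k₀ + 1 by ring, pow_succ]
        gcongr
        norm_num
    _ ≤ P k (i k) * cum (Special k (i k)) (bas k) 1 :=
        mul_le_mul (h.P_ge hk) (half_le_cum_one (h.not_special hk)) (by norm_num) (P_nonneg _ _)
    _ = F (k + 1) (i k * bas k + 1) - F (k + 1) (i k * bas k) := by
        rw [F_child _ (bas_pos k), F_refine_succ]; ring
    _ = _ := (gapMeasure_real_Ioc (Nat.le_succ _)).symm
    _ ≤ _ := by
        refine measureReal_mono fun y hy => mem_ball_of_abs_le (by positivity) ?_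
        obtain ⟨g1, g2⟩ := hx k hk
        obtain ⟨g3, g4⟩ := hy
        have e1 : ((i k * bas k : ℕ) : ℝ) / 3 ^ lev (k + 1) = i k / 3 ^ lev k := by
          rw [pow_lev_succ_cast]; push_cast; field_simp
        have e2 : (((i k * bas k).succ : ℕ) : ℝ) / 3 ^ lev (k + 1) =
            i k / 3 ^ lev k + 1 / 3 ^ lev (k + 1) := by
          rw [← e1]; push_cast; ring
        rw [e1] at g3
        rw [e2] at g4
        have g5 : (1 : ℝ) / 3 ^ lev (k + 1) ≤ 1 / 3 ^ E k := by
          gcongr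
          · norm_num
          · exact hElev k hk
        rw [← sub_mul, abs_mul, abs_of_pos (by positivity : (0 : ℝ) < 3 ^ E k),
          ← le_div_iff₀ (by positivity), abs_le]
        constructor <;> linarith

end IsChain

section Cantor

/-- The total number of free ternary digits above level `k`, when the digits chosen from level `k`
to level `k + 1` range over `3 ^ b k` values. -/
def freeDigits (b : ℕ → ℕ) (k : ℕ) : ℕ := ∑ j ∈ Finset.range k, b j

/-- The digit of `y` selecting a child at level `k`. -/
noncomputable def dig (b : ℕ → ℕ) (y : ℝ) (k : ℕ) : ℕ :=
  ⌊y * 3 ^ freeDigits b (k + 1)⌋₊ % 3 ^ b k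

/-- The index of the cell of level `k` selected by the digits of `y`. -/
noncomputable def idx (b : ℕ → ℕ) (y : ℝ) : ℕ → ℕ
  | 0 => 0
  | k + 1 => idx b y k * bas k + dig b y k

/-- The point of the Cantor set with digits those of `y`. -/
noncomputable def pt (b : ℕ → ℕ) (y : ℝ) : ℝ := ⨆ k, (idx b y k : ℝ) / 3 ^ lev k

variable {b : ℕ → ℕ}

theorem freeDigits_succ (b : ℕ → ℕ) (k : ℕ) : freeDigits b (k + 1) = freeDigits b k + b k :=
  Finset.sum_range_succ _ _

theorem dig_lt (b : ℕ → ℕ) (y : ℝ) (k : ℕ) : dig b y k < 3 ^ b k := Nat.mod_lt _ (by positivity)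

theorem idx_succ_div (b : ℕ → ℕ) (y : ℝ) (k : ℕ) :
    (idx b y (k + 1) : ℝ) / 3 ^ lev (k + 1) =
      idx b y k / 3 ^ lev k + dig b y k / 3 ^ lev (k + 1) := by
  have hb : (0 : ℝ) < bas k := by exact_mod_cast bas_pos k
  rw [idx, pow_lev_succ_cast]
  push_cast
  field_simp

theorem pt_mem (hb : ∀ k, b k + lev k + 1 ≤ lev (k + 1)) (y : ℝ) (k : ℕ) :
    pt b y ∈ Icc ((idx b y k : ℝ) / 3 ^ lev k)
      (idx b y k / 3 ^ lev k + 1 / 3 ^ (lev (k + 1) - b k)) := by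
  have hmono : Monotone fun k => (idx b y k : ℝ) / 3 ^ lev k := by
    refine monotone_nat_of_le_succ fun k => ?_
    rw [idx_succ_div]
    exact le_add_of_nonneg_right (by positivity)
  have hanti : Antitone fun k => (idx b y k : ℝ) / 3 ^ lev k + 1 / 3 ^ (lev (k + 1) - b k) := by
    refine antitone_nat_of_succ_le fun k => ?_
    rw [idx_succ_div, add_assoc]
    gcongr
    have h1 : (1 : ℝ) / 3 ^ (lev (k + 1 + 1) - b (k + 1)) ≤ 1 / 3 ^ lev (k + 1) := by
      gcongr
      · norm_num
      · have := hb (k + 1); omega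
    have h2 : (1 : ℝ) / 3 ^ (lev (k + 1) - b k) = 3 ^ b k / 3 ^ lev (k + 1) := by
      rw [pow_sub₀ _ (by norm_num) (by have := hb k; omega)]
      field_simp
    have h3 : (dig b y k : ℝ) + 1 ≤ 3 ^ b k := by exact_mod_cast dig_lt b y k
    calc _ ≤ (dig b y k : ℝ) / 3 ^ lev (k + 1) + 1 / 3 ^ lev (k + 1) := by gcongr
      _ = (dig b y k + 1) / 3 ^ lev (k + 1) := by ring
      _ ≤ _ := by rw [h2]; gcongr
  have := hmono.ciSup_mem_iInter_Icc_of_antitone hanti fun k => by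
    simp only [le_add_iff_nonneg_right]; positivity
  exact mem_iInter.1 this k

theorem floor_eq_add_dig (b : ℕ → ℕ) (y : ℝ) (k : ℕ) :
    ⌊y * 3 ^ freeDigits b (k + 1)⌋₊ = ⌊y * 3 ^ freeDigits b k⌋₊ * 3 ^ b k + dig b y k := by
  have h : ⌊y * 3 ^ freeDigits b k⌋₊ = ⌊y * 3 ^ freeDigits b (k + 1)⌋₊ / 3 ^ b k := by
    rw [← Nat.floor_div_natCast, freeDigits_succ, pow_add]
    congr 1
    push_cast
    field_simp
  rw [h, dig, Nat.div_add_mod']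

theorem sub_le_mul_rpow (hb : ∀ k, b k + lev k + 1 ≤ lev (k + 1))
    (hinf : Tendsto (freeDigits b) atTop atTop) {h : ℝ} (h0 : 0 < h) (h1 : h < 1) {C : ℕ}
    (hC : ∀ k, h * (lev (k + 1) - b k : ℕ) ≤ freeDigits b k + C) {y y' : ℝ}
    (hy : y ∈ Ico (0 : ℝ) 1) (hy' : y' ∈ Ico (0 : ℝ) 1) (hlt : y < y') :
    0 < pt b y' - pt b y ∧ y' - y ≤ 3 ^ (C + 1) * (pt b y' - pt b y) ^ h := by
  have hex : ∃ k, ⌊y * 3 ^ freeDigits b k⌋₊ ≠ ⌊y' * 3 ^ freeDigits b k⌋₊ := by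
    have hpow : Tendsto (fun k => (3 : ℝ) ^ freeDigits b k) atTop atTop :=
      (tendsto_pow_atTop_atTop_of_one_lt (by norm_num)).comp hinf
    obtain ⟨k, hk⟩ := (hpow.eventually_ge_atTop (1 / (y' - y))).exists
    refine ⟨k, fun he => ?_⟩
    rw [div_le_iff₀ (by linarith)] at hk
    have g1 := Nat.lt_floor_add_one (y' * 3 ^ freeDigits b k)
    have g2 := Nat.floor_le (mul_nonneg hy.1 (by positivity : (0 : ℝ) ≤ 3 ^ freeDigits b k))
    rw [he] at g2
    linarith
  obtain ⟨k, hk, hmin⟩ : ∃ k, ⌊y * 3 ^ freeDigits b (k + 1)⌋₊ ≠ ⌊y' * 3 ^ freeDigits b (k + 1)⌋₊ ∧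
      ∀ j ≤ k, ⌊y * 3 ^ freeDigits b j⌋₊ = ⌊y' * 3 ^ freeDigits b j⌋₊ := by
    have hs := Nat.find_spec hex
    have hm := fun j => Nat.find_min hex (m := j)
    cases hk : Nat.find hex with
    | zero =>
      rw [hk] at hs
      simp [freeDigits, Nat.floor_eq_zero.2 hy.2, Nat.floor_eq_zero.2 hy'.2] at hs
    | succ k =>
      rw [hk] at hs hm
      exact ⟨k, hs, fun j hj => not_not.1 (hm j (by omega))⟩
  have hidx : ∀ j ≤ k, idx b y j = idx b y' j := by
    intro j
    induction j with
    | zero => intro _; rfl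
    | succ j ih =>
      intro hj
      rw [idx, idx, ih (by omega), dig, dig, hmin (j + 1) hj]
  obtain ⟨g, hg⟩ : ∃ g, g = ⌊y * 3 ^ freeDigits b (k + 1)⌋₊ := ⟨_, rfl⟩
  obtain ⟨g', hg'⟩ : ∃ g, g = ⌊y' * 3 ^ freeDigits b (k + 1)⌋₊ := ⟨_, rfl⟩
  have hgg : g < g' := by
    refine lt_of_le_of_ne ?_ (by rw [hg, hg']; exact hk)
    rw [hg, hg']
    exact Nat.floor_mono (by gcongr)
  have e1 := floor_eq_add_dig b y k
  have e2 := floor_eq_add_dig b y' k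
  rw [← hg, hmin k le_rfl] at e1
  rw [← hg'] at e2
  obtain ⟨j, hj⟩ : ∃ j, dig b y' k = dig b y k + j := ⟨dig b y' k - dig b y k, by omega⟩
  have hj1 : (1 : ℝ) ≤ j := by exact_mod_cast (by omega : 1 ≤ j)
  have hjb : (j : ℝ) ≤ 3 ^ b k := by
    exact_mod_cast (by have := dig_lt b y' k; omega : j ≤ 3 ^ b k)
  have hgj : (g' : ℝ) = g + j := by exact_mod_cast (by omega : g' = g + j)
  -- the parameters differ by at most `2 j` units
  have hyy : y' - y ≤ 2 * j / 3 ^ freeDigits b (k + 1) := by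
    rw [le_div_iff₀ (by positivity), sub_mul]
    have g1 := Nat.lt_floor_add_one (y' * 3 ^ freeDigits b (k + 1))
    have g2 := Nat.floor_le (mul_nonneg hy.1 (by positivity : (0 : ℝ) ≤ 3 ^ freeDigits b (k + 1)))
    rw [← hg] at g2
    rw [← hg'] at g1
    linarith
  -- the points differ by at least `2 j / 3` units
  have hpt : 2 / 3 * (j / 3 ^ lev (k + 1)) ≤ pt b y' - pt b y := by
    have p1 := (pt_mem hb y (k + 1)).2
    have p2 := (pt_mem hb y' (k + 1)).1
    rw [idx_succ_div] at p1 p2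
    rw [← hidx k le_rfl, hj] at p2
    have p3 : (1 : ℝ) / 3 ^ (lev (k + 1 + 1) - b (k + 1)) ≤ 1 / 3 ^ (lev (k + 1) + 1) := by
      gcongr
      · norm_num
      · have := hb (k + 1); omega
    have p4 : (1 : ℝ) / 3 ^ (lev (k + 1) + 1) ≤ 1 / 3 * (j / 3 ^ lev (k + 1)) := by
      rw [pow_succ, mul_comm, ← one_div_mul_one_div]
      gcongr
    push_cast at p2
    rw [add_div] at p2
    linarith
  have hpos : 0 < 2 / 3 * ((j : ℝ) / 3 ^ lev (k + 1)) := by positivity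
  refine ⟨hpos.trans_le hpt, hyy.trans ?_⟩
  obtain ⟨θ, hθ⟩ : ∃ θ : ℝ, θ = j / 3 ^ b k := ⟨_, rfl⟩
  have hθ0 : 0 < θ := by rw [hθ]; positivity
  have hθ1 : θ ≤ 1 := by rw [hθ]; exact div_le_one_of_le₀ hjb (by positivity)
  have hE : (j : ℝ) / 3 ^ lev (k + 1) = θ * 3 ^ (-((lev (k + 1) - b k : ℕ) : ℝ)) := by
    rw [three_rpow_neg_natCast, hθ, pow_sub₀ _ (by norm_num) (by have := hb k; omega)]
    field_simp
  calc 2 * (j : ℝ) / 3 ^ freeDigits b (k + 1) = 2 * θ * 3 ^ (-(freeDigits b k : ℝ)) := by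
        rw [three_rpow_neg_natCast, hθ, freeDigits_succ, pow_add]
        field_simp
    _ ≤ 2 * θ ^ h * 3 ^ (C - h * (lev (k + 1) - b k : ℕ) : ℝ) := by
        gcongr
        · exact Real.self_le_rpow_of_le_one hθ0.le hθ1 h1.le
        · norm_num
        · have := hC k; linarith
    _ = 3 ^ (C + 1) * (2 / 3 * (θ * 3 ^ (-((lev (k + 1) - b k : ℕ) : ℝ))) ^ h) := by
        rw [Real.mul_rpow hθ0.le (by positivity), ← Real.rpow_mul (by norm_num), sub_eq_add_neg,
          Real.rpow_add (by norm_num), Real.rpow_natCast, pow_succ,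
          show -((lev (k + 1) - b k : ℕ) : ℝ) * h = -(h * (lev (k + 1) - b k : ℕ)) by ring]
        ring
    _ ≤ 3 ^ (C + 1) * (2 / 3 * ((j : ℝ) / 3 ^ lev (k + 1))) ^ h := by
        have hle : (2 / 3 : ℝ) ≤ (2 / 3) ^ h :=
          Real.self_le_rpow_of_le_one (by norm_num) (by norm_num) h1.le
        rw [hE, Real.mul_rpow (x := 2 / 3) (by norm_num) (by positivity)]
        gcongr
    _ ≤ _ := by gcongr

theorem hausdorffMeasure_range_pt_ne_zero (hb : ∀ k, b k + lev k + 1 ≤ lev (k + 1))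
    (hinf : Tendsto (freeDigits b) atTop atTop) {h : ℝ} (h0 : 0 < h) (h1 : h < 1) {C : ℕ}
    (hC : ∀ k, h * (lev (k + 1) - b k : ℕ) ≤ freeDigits b k + C) (a : ℝ) :
    μH[h] ((fun y => a + pt b y) '' Ico (0 : ℝ) 1) ≠ 0 := by
  set D : ℝ → ℝ := fun y => a + pt b y with hD
  have key : ∀ {y y'}, y ∈ Ico (0 : ℝ) 1 → y' ∈ Ico (0 : ℝ) 1 → y ≠ y' →
      0 < |D y - D y'| ∧ |y - y'| ≤ 3 ^ (C + 1) * |D y - D y'| ^ h := by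
    have aux : ∀ {y y'}, y ∈ Ico (0 : ℝ) 1 → y' ∈ Ico (0 : ℝ) 1 → y < y' →
        0 < |D y' - D y| ∧ |y' - y| ≤ 3 ^ (C + 1) * |D y' - D y| ^ h := by
      intro y y' hy hy' hlt
      obtain ⟨g1, g2⟩ := sub_le_mul_rpow hb hinf h0 h1 hC hy hy' hlt
      rw [hD, add_sub_add_left_eq_sub, abs_of_pos g1, abs_of_pos (sub_pos.2 hlt)]
      exact ⟨g1, g2⟩
    intro y y' hy hy' hne
    rcases hne.lt_or_gt with hlt | hlt
    · rw [abs_sub_comm, abs_sub_comm y y']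
      exact aux hy hy' hlt
    · exact aux hy' hy hlt
  have hinj : InjOn D (Ico 0 1) := by
    intro y hy y' hy' he
    by_contra hne
    have := (key hy hy' hne).1
    rw [he, sub_self, abs_zero] at this
    exact this.false
  set g := Function.invFunOn D (Ico (0 : ℝ) 1)
  have hleft : ∀ y ∈ Ico (0 : ℝ) 1, g (D y) = y := hinj.leftInvOn_invFunOn
  have hhol : HolderOnWith (3 ^ (C + 1)) h.toNNReal g (D '' Ico 0 1) := by
    rintro _ ⟨y, hy, rfl⟩ _ ⟨y', hy', rfl⟩
    rw [hleft y hy, hleft y' hy']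
    rcases eq_or_ne y y' with rfl | hne
    · simp
    · obtain ⟨g1, g2⟩ := key hy hy' hne
      rw [edist_dist, edist_dist, Real.dist_eq, Real.dist_eq, Real.coe_toNNReal h h0.le,
        ENNReal.ofReal_rpow_of_pos g1]
      refine (ENNReal.ofReal_le_ofReal g2).trans (le_of_eq ?_)
      rw [ENNReal.ofReal_mul (by positivity), ENNReal.ofReal_pow (by norm_num)]
      norm_num
  have himg : g '' (D '' Ico 0 1) = Ico 0 1 := by
    rw [image_image]
    exact (image_congr hleft).trans (image_id' _)
  have hle := hhol.hausdorffMeasure_image_le (d := 1) (Real.toNNReal_pos.2 h0) zero_le_one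
  rw [himg, hausdorffMeasure_real, Real.volume_Ico, Real.coe_toNNReal h h0.le, mul_one] at hle
  intro hzero
  rw [hzero, mul_zero] at hle
  norm_num at hle

theorem idx_eq_zero {k₀ : ℕ} (h0 : ∀ k < k₀, b k = 0) (y : ℝ) : idx b y k₀ = 0 := by
  induction k₀ with
  | zero => rfl
  | succ k ih =>
    have := dig_lt b y k
    rw [h0 k (Nat.lt_succ_self k), pow_zero, Nat.lt_one_iff] at this
    rw [idx, ih fun j hj => h0 j (by omega), this]
    ring

theorem isChain_idx (hb : ∀ k, b k + lev k + 1 ≤ lev (k + 1)) {k₀ i₀ : ℕ}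
    (h0 : ∀ k < k₀, b k = 0) (hi : i₀ < 3 ^ lev k₀) (hS : ¬ Special k₀ i₀) (y : ℝ) :
    IsChain k₀ fun k => i₀ * 3 ^ (lev k - lev k₀) + idx b y k where
  lt_pow := by simpa [idx_eq_zero h0] using hi
  ordinary := by simpa [idx_eq_zero h0] using hS
  step := by
    intro k hk
    have hbas : 3 * 3 ^ b k ≤ bas k := by
      rw [← pow_succ', bas]
      refine Nat.pow_le_pow_right (by norm_num) ?_
      have := hb k
      rw [lev_succ, add_mul, one_mul] at this
      omega
    refine ⟨dig b y k, by have := dig_lt b y k; omega, ?_⟩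
    have : 3 ^ (lev (k + 1) - lev k₀) = 3 ^ (lev k - lev k₀) * bas k := by
      have := lev_strictMono.monotone hk
      rw [bas, ← pow_add, lev_succ, add_mul, one_mul]
      congr 1
      omega
    rw [idx, this]
    ring

theorem cantor_cell_bounds (hb : ∀ k, b k + lev k + 1 ≤ lev (k + 1)) {k₀ : ℕ} (i₀ : ℕ) (y : ℝ)
    {k : ℕ} (hk : k₀ ≤ k) :
    ((i₀ * 3 ^ (lev k - lev k₀) + idx b y k : ℕ) : ℝ) / 3 ^ lev k ≤ i₀ / 3 ^ lev k₀ + pt b y ∧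
    i₀ / 3 ^ lev k₀ + pt b y ≤ ((i₀ * 3 ^ (lev k - lev k₀) + idx b y k : ℕ) : ℝ) / 3 ^ lev k +
      1 / 3 ^ (lev (k + 1) - b k) := by
  have e : ((i₀ * 3 ^ (lev k - lev k₀) + idx b y k : ℕ) : ℝ) / 3 ^ lev k =
      i₀ / 3 ^ lev k₀ + idx b y k / 3 ^ lev k := by
    push_cast
    rw [pow_sub₀ _ (by norm_num) (lev_strictMono.monotone hk)]
    field_simp
  obtain ⟨h1, h2⟩ := pt_mem hb y k
  rw [e]
  constructor <;> linarith

end Cantor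

/-- Exponents for a Cantor set of dimension `h` whose points have local dimension at most `h`:
at level `k`, its points lie within `3 ^ (-e k)` of the left endpoints of their cells. -/
theorem exists_exponents {h : ℝ} (h0 : 0 < h) (h1 : h < 1) :
    ∃ e : ℕ → ℕ, (∃ K, ∀ k ≥ K, lev k + 1 ≤ e k ∧ e k ≤ lev (k + 1) ∧ h * e k ≤ lev k ∧
      h * e (k + 1) + e k ≤ lev (k + 1)) ∧
      ∀ t > h, ∀ c : ℝ, ∀ᶠ k in atTop, (k + 1 + lev k + c : ℝ) ≤ t * e k := by
  obtain ⟨e, he⟩ : ∃ e : ℕ → ℕ, ∀ k, e k = ⌊(lev k - lev (k - 1) / h) / h⌋₊ := ⟨_, fun _ => rfl⟩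
  have hlow : ∀ j, ((lev (j + 1) - lev j / h) / h : ℝ) - 1 ≤ e (j + 1) := by
    intro j
    rw [he, Nat.add_sub_cancel]
    exact (Nat.sub_one_lt_floor _).le
  have hh : 0 < 1 / h - 1 := by rw [sub_pos]; exact one_lt_one_div h0 h1
  have hsplit : ∀ j, ((lev (j + 1) - lev j / h) / h : ℝ) =
      1 / h * lev (j + 1) - 1 / h ^ 2 * lev j := by
    intro j
    field_simp
  refine ⟨e, ?_, ?_⟩
  · obtain ⟨K, hK⟩ := eventually_atTop.1 ((eventually_lev_le hh (1 / h ^ 2 + 2)).and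
      (eventually_lev_le one_pos (1 / h)))
    have hnn : ∀ j, (0 : ℝ) ≤ lev j := fun j => Nat.cast_nonneg _
    have hbig : ∀ j ≥ K, (lev (j + 1) + 2 : ℝ) ≤ (lev (j + 1) - lev j / h) / h := by
      intro j hj
      rw [hsplit]
      have := (hK j hj).1
      have h3 : 0 ≤ 1 / h ^ 2 := by positivity
      linarith [hnn j]
    have hup : ∀ j ≥ K, h * e (j + 1) ≤ lev (j + 1) - lev j / h := by
      intro j hj
      have : (e (j + 1) : ℝ) ≤ (lev (j + 1) - lev j / h) / h := by
        rw [he, Nat.add_sub_cancel]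
        exact Nat.floor_le (by linarith [hbig j hj, hnn (j + 1)])
      rwa [le_div_iff₀ h0, mul_comm] at this
    have hup' : ∀ k ≥ K + 1, h * e k ≤ lev k := by
      intro k hk
      obtain ⟨j, rfl⟩ : ∃ j, k = j + 1 := ⟨k - 1, by omega⟩
      have : 0 ≤ lev j / h := div_nonneg (hnn j) h0.le
      linarith [hup j (by omega)]
    have hdiv : ∀ k ≥ K + 1, (e k : ℝ) ≤ lev k / h := by
      intro k hk
      rw [le_div_iff₀ h0, mul_comm]
      exact hup' k hk
    refine ⟨K + 1, fun k hk => ⟨?_, ?_, hup' k hk, ?_⟩⟩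
    · obtain ⟨j, rfl⟩ : ∃ j, k = j + 1 := ⟨k - 1, by omega⟩
      have := hbig j (by omega)
      exact_mod_cast (by linarith [hlow j] : (lev (j + 1) + 1 : ℝ) ≤ e (j + 1))
    · have h2 := (hK k (by omega)).2
      have h3 : 0 ≤ 1 / h := by positivity
      have h4 : (lev k : ℝ) / h = 1 / h * lev k := by ring
      exact_mod_cast (by linarith [hdiv k hk] : (e k : ℝ) ≤ lev (k + 1))
    · linarith [hup k (by omega), hdiv k hk]
  · intro t ht c
    have hτ : 0 < t / h - 1 := by rw [sub_pos]; exact (one_lt_div h0).2 ht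
    obtain ⟨K, hK⟩ := eventually_atTop.1 (eventually_lev_le hτ (2 + |c| + t + t / h ^ 2))
    filter_upwards [eventually_ge_atTop (K + 1)] with k hk
    obtain ⟨j, rfl⟩ : ∃ j, k = j + 1 := ⟨k - 1, by omega⟩
    have h2 := hK j (by omega)
    have h3 := hlow j
    rw [hsplit] at h3
    have h4 : (j : ℝ) ≤ lev j := by exact_mod_cast le_lev j
    have h5 := mul_le_mul_of_nonneg_left h3 (h0.trans ht).le
    have h6 : t * (1 / h * lev (j + 1) - 1 / h ^ 2 * lev j - 1 : ℝ) =
      t / h * lev (j + 1) - t / h ^ 2 * lev j - t := by ring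
    have h7 : 0 ≤ t / h ^ 2 := div_nonneg (h0.trans ht).le (by positivity)
    have h8 : 0 ≤ (|c| + t) * (lev j : ℝ) :=
      mul_nonneg (add_nonneg (abs_nonneg c) (h0.trans ht).le) (Nat.cast_nonneg _)
    push_cast
    nlinarith [le_abs_self c, (Nat.cast_nonneg (lev j) : (0 : ℝ) ≤ lev j)]

theorem exists_cantor {h : ℝ} (h0 : 0 < h) (h1 : h < 1) :
    ∃ K, ∀ k₀ ≥ K, ∀ i₀ < 3 ^ lev k₀, ¬ Special k₀ i₀ →
      ∃ B ⊆ Icc (i₀ / 3 ^ lev k₀ : ℝ) ((i₀ + 1) / 3 ^ lev k₀),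
        (∀ x ∈ B, locDim gapMeasure x ≤ (h : EReal)) ∧ μH[h] B ≠ 0 := by
  obtain ⟨e, ⟨K, hK⟩, ht⟩ := exists_exponents h0 h1
  refine ⟨K, fun k₀ hk₀ i₀ hi₀ hS => ?_⟩
  obtain ⟨b, hb0, hb1⟩ : ∃ b : ℕ → ℕ, (∀ k < k₀, b k = 0) ∧ ∀ k ≥ k₀, b k = lev (k + 1) - e k :=
    ⟨fun k => if k < k₀ then 0 else lev (k + 1) - e k, fun k hk => if_pos hk,
      fun k hk => if_neg hk.not_gt⟩
  have hE : ∀ k ≥ k₀, lev (k + 1) - b k = e k := by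
    intro k hk
    have := hK k (by omega)
    rw [hb1 k hk]
    omega
  have hb : ∀ k, b k + lev k + 1 ≤ lev (k + 1) := by
    intro k
    rcases lt_or_ge k k₀ with hk | hk
    · rw [hb0 k hk]
      have := lev_lt_succ k
      omega
    · have := hK k (by omega)
      rw [hb1 k hk]
      omega
  have hfree : ∀ k ≥ k₀, h * e (k + 1) ≤ freeDigits b (k + 1) := by
    intro k hk
    obtain ⟨-, g2, -, g4⟩ := hK k (by omega)
    have h3 : b k ≤ freeDigits b (k + 1) := by rw [freeDigits_succ]; omega
    have h4 : (lev (k + 1) : ℝ) = b k + e k := by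
      exact_mod_cast (by rw [hb1 k hk]; omega : lev (k + 1) = b k + e k)
    have h5 : (b k : ℝ) ≤ freeDigits b (k + 1) := by exact_mod_cast h3
    linarith
  have hC : ∀ k, h * (lev (k + 1) - b k : ℕ) ≤ freeDigits b k + lev k₀ := by
    intro k
    have hf : (0 : ℝ) ≤ freeDigits b k := Nat.cast_nonneg _
    have hl : (0 : ℝ) ≤ lev k₀ := Nat.cast_nonneg _
    rcases lt_or_ge k k₀ with hk | hk
    · have h2 : ((lev (k + 1) - b k : ℕ) : ℝ) ≤ lev k₀ := by
        have : lev (k + 1) ≤ lev k₀ := lev_strictMono.monotone hk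
        exact_mod_cast (by omega : lev (k + 1) - b k ≤ lev k₀)
      nlinarith
    · rw [hE k hk]
      rcases hk.eq_or_lt with rfl | hk
      · linarith [(hK k₀ hk₀).2.2.1]
      · obtain ⟨j, rfl⟩ : ∃ j, k = j + 1 := ⟨k - 1, by omega⟩
        linarith [hfree j (by omega)]
  have hinf : Tendsto (freeDigits b) atTop atTop := by
    rw [← tendsto_natCast_atTop_iff (R := ℝ), ← tendsto_add_atTop_iff_nat 1]
    refine tendsto_atTop_mono' _ ?_
      ((tendsto_natCast_atTop_atTop (R := ℝ)).const_mul_atTop h0)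
    filter_upwards [eventually_ge_atTop k₀] with k hk
    refine le_trans ?_ (hfree k hk)
    have h2 := (hK (k + 1) (by omega)).1
    have h3 := le_lev (k + 1)
    have : (k : ℝ) ≤ e (k + 1) := by exact_mod_cast (by omega : k ≤ e (k + 1))
    gcongr
  refine ⟨_, ?_, ?_, hausdorffMeasure_range_pt_ne_zero hb hinf h0 h1 hC (i₀ / 3 ^ lev k₀)⟩
  · rintro _ ⟨y, -, rfl⟩
    have := cantor_cell_bounds hb i₀ y (le_refl k₀)
    rw [idx_eq_zero hb0, Nat.sub_self, pow_zero, mul_one, add_zero] at this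
    refine ⟨this.1, this.2.trans ?_⟩
    rw [add_div]
    gcongr
    · norm_num
    · have := hb k₀
      omega
  · rintro _ ⟨y, -, rfl⟩
    refine (isChain_idx hb hb0 hi₀ hS y).locDim_le h0.le (E := fun k => lev (k + 1) - b k) ?_
      (fun k _ => Nat.sub_le _ _) (fun k hk => cantor_cell_bounds hb i₀ y hk) ?_
    · refine tendsto_atTop_mono (fun k => ?_) tendsto_id
      have := hb k
      have := le_lev k
      simp only [id]
      omega
    · intro t hth
      filter_upwards [ht t hth (lev k₀ + t), eventually_ge_atTop k₀] with k g1 g2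
      rw [hE k g2]
      linarith

theorem locDim_left {k i : ℕ} (hi : i < 3 ^ lev k) (hS : ¬ Special k i) :
    locDim gapMeasure (i / 3 ^ lev k) = ((0 : ℝ) : EReal) := by
  refine le_antisymm ?_ (by exact_mod_cast locDim_nonneg _)
  have hb : ∀ k, (0 : ℕ → ℕ) k + lev k + 1 ≤ lev (k + 1) := by
    intro k
    have := lev_lt_succ k
    simp only [Pi.zero_apply]
    omega
  refine (isChain_idx hb (fun _ _ => rfl) hi hS 0).locDim_le le_rfl (E := fun k => lev (k + 1))
    (lev_strictMono.tendsto_atTop.comp (tendsto_add_atTop_nat 1)) (fun _ _ => le_rfl) ?_ ?_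
  · intro j hj
    have h3 : idx 0 0 j = 0 := idx_eq_zero (fun _ _ => rfl) 0
    have e : ((i * 3 ^ (lev j - lev k) + idx 0 0 j : ℕ) : ℝ) / 3 ^ lev j = i / 3 ^ lev k := by
      rw [h3]
      push_cast
      rw [pow_sub₀ _ (by norm_num) (lev_strictMono.monotone hj)]
      field_simp
      ring
    rw [e]
    exact ⟨le_rfl, le_add_of_nonneg_right (by positivity)⟩
  · intro t ht
    filter_upwards [eventually_lev_le ht (lev k + t + 2)] with j hj
    have h4 : (j : ℝ) ≤ lev j := by exact_mod_cast le_lev j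
    have h5 : (0 : ℝ) ≤ (lev k + t) * lev j := by positivity
    nlinarith

theorem child_bounds {k d : ℕ} (i : ℕ) (hd : d < bas k) :
    (i / 3 ^ lev k : ℝ) ≤ (i * bas k + d : ℕ) / 3 ^ lev (k + 1) ∧
      ((i * bas k + d : ℕ) + 1 : ℝ) / 3 ^ lev (k + 1) ≤ (i + 1) / 3 ^ lev k := by
  have hb : (0 : ℝ) < bas k := by exact_mod_cast bas_pos k
  have hd' : (d + 1 : ℝ) ≤ bas k := by exact_mod_cast hd
  rw [pow_lev_succ_cast]
  push_cast
  constructor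
  · rw [← mul_div_mul_right _ _ hb.ne']
    gcongr
    exact le_add_of_nonneg_right (Nat.cast_nonneg d)
  · rw [← mul_div_mul_right ((i : ℝ) + 1) _ hb.ne']
    gcongr
    linarith

theorem child_lt {k i d : ℕ} (hi : i < 3 ^ lev k) (hd : d < bas k) :
    i * bas k + d < 3 ^ lev (k + 1) := by
  rw [pow_lev_succ]
  nlinarith

variable {a b : ℝ}

theorem exists_ordinary (ha : 0 ≤ a) (hab : a < b) (hb : b ≤ 1) (K : ℕ) :
    ∃ k ≥ K, ∃ i < 3 ^ lev k, ¬ Special k i ∧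
      a < i / 3 ^ lev k ∧ ((i : ℝ) + 1) / 3 ^ lev k < b := by
  obtain ⟨k, hk, hkK⟩ := ((tendsto_pow_lev.eventually_lt_const
    (by linarith : 0 < (b - a) / 3)).and (eventually_ge_atTop K)).exists
  have hN : (0 : ℝ) < 3 ^ lev k := by positivity
  rw [one_div_pow, div_lt_iff₀ hN] at hk
  obtain ⟨i, hi⟩ : ∃ i, i = ⌊a * 3 ^ lev k⌋₊ + 1 := ⟨_, rfl⟩
  have h1 : a * 3 ^ lev k < i := by
    rw [hi]; push_cast; exact Nat.lt_floor_add_one _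
  have h2 : (i : ℝ) ≤ a * 3 ^ lev k + 1 := by
    rw [hi]; push_cast; gcongr; exact Nat.floor_le (by positivity)
  have h3 : (i : ℝ) + 1 < b * 3 ^ lev k := by linarith
  have h4 : i < 3 ^ lev k := by
    have : b * 3 ^ lev k ≤ 3 ^ lev k := mul_le_of_le_one_left hN.le hb
    exact_mod_cast (by linarith : (i : ℝ) < 3 ^ lev k)
  have h5 : a < i / 3 ^ lev k := (lt_div_iff₀ hN).2 h1
  have h6 : ((i : ℝ) + 1) / 3 ^ lev k < b := (div_lt_iff₀ hN).2 h3
  by_cases hS : Special k i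
  · obtain ⟨g1, g2⟩ := child_bounds i (bas_pos k)
    refine ⟨k + 1, by omega, i * bas k + 0, child_lt h4 (bas_pos k), ?_, h5.trans_le g1,
      g2.trans_lt h6⟩
    rw [special_child i (bas_pos k)]
    have := bas_ge k
    rintro (⟨-, h⟩ | ⟨h, -⟩)
    · omega
    · exact h hS
  · exact ⟨k, hkK, i, h4, hS, h5, h6⟩

theorem exists_centre (ha : 0 ≤ a) (hab : a < b) (hb : b ≤ 1) :
    ∃ x ∈ Ioo a b, locDim gapMeasure x = ((2 : ℝ) : EReal) := by
  obtain ⟨k, -, i, hi, hS, h1, h2⟩ := exists_ordinary ha hab hb 0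
  have hd : bas k - 1 < bas k := Nat.sub_lt (bas_pos k) one_pos
  obtain ⟨g1, g2⟩ := child_bounds i hd
  refine ⟨_, ⟨?_, ?_⟩, locDim_cen ((special_child i hd).2 (Or.inr ⟨hS, rfl⟩)) (child_lt hi hd)⟩
  · refine h1.trans_le (g1.trans ?_)
    rw [cen, ← mul_div_mul_left _ _ (two_ne_zero' ℝ)]
    gcongr
    linarith
  · refine lt_of_le_of_lt (le_trans ?_ g2) h2
    rw [cen, ← mul_div_mul_left (((_ : ℕ) : ℝ) + 1) _ (two_ne_zero' ℝ)]
    gcongr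
    linarith

theorem locDim_eq_two {x : ℝ} (hx : x ∈ centres) : locDim gapMeasure x = ((2 : ℝ) : EReal) := by
  obtain ⟨k, i, hS, hi, rfl⟩ := hx
  exact locDim_cen hS hi

/-- Sets of positive `h`-dimensional measure inside an interval, of local dimension at most `h`. -/
theorem exists_hausdorffMeasure_ne_zero (ha : 0 ≤ a) (hab : a < b) (hb : b ≤ 1) {h : ℝ}
    (h0 : 0 < h) (h1 : h ≤ 1) :
    ∃ B ⊆ Ioo a b, (∀ x ∈ B, locDim gapMeasure x ≤ (h : EReal)) ∧ μH[h] B ≠ 0 := by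
  rcases h1.eq_or_lt with rfl | h1
  · refine ⟨Ioo a b \ centres, sdiff_subset, fun x hx =>
      locDim_le_one ⟨ha.trans hx.1.1.le, hx.1.2.le.trans hb⟩ hx.2, ?_⟩
    rw [hausdorffMeasure_real, measure_sdiff_null (countable_centres.measure_zero _),
      Real.volume_Ioo]
    simpa using hab
  · obtain ⟨K, hK⟩ := exists_cantor h0 h1
    obtain ⟨k, hk, i, hi, hS, g1, g2⟩ := exists_ordinary ha hab hb K
    obtain ⟨B, hB, hB'⟩ := hK k hk i hi hS
    exact ⟨B, fun x hx => ⟨g1.trans_le (hB hx).1, (hB hx).2.trans_lt g2⟩, hB'⟩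

theorem dimH_level_le {h : ℝ} (h0 : 0 ≤ h) (T : Set ℝ) :
    dimH {x ∈ T | locDim gapMeasure x = (h : EReal)} ≤ ENNReal.ofReal h := by
  by_contra! hlt
  obtain ⟨r, hr, hr'⟩ := ENNReal.lt_iff_exists_nnreal_btwn.1 hlt
  have hhr : h < r := by
    rwa [← ENNReal.ofReal_coe_nnreal, ENNReal.ofReal_lt_ofReal_iff_of_nonneg h0] at hr
  refine hr'.not_ge (dimH_le_of_hausdorffMeasure_ne_top ?_)
  rw [measure_mono_null _ (hausdorffMeasure_locDim_lt_eq_zero (μ := gapMeasure)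
    (h0.trans_lt hhr))]
  · exact ENNReal.zero_ne_top
  · rintro x ⟨-, hx⟩
    rw [mem_ofPred_eq, hx]
    exact_mod_cast hhr

variable {T : Set ℝ}

theorem dimHE_level (ha : 0 ≤ a) (hab : a < b) (hb : b ≤ 1) (hT : Ioo a b ⊆ T) {h : ℝ}
    (h0 : 0 ≤ h) (h1 : h ≤ 1) :
    dimHE {x ∈ T | locDim gapMeasure x = (h : EReal)} = (h : EReal) := by
  obtain ⟨hne, hge⟩ : {x ∈ T | locDim gapMeasure x = (h : EReal)}.Nonempty ∧
      ENNReal.ofReal h ≤ dimH {x ∈ T | locDim gapMeasure x = (h : EReal)} := by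
    rcases h0.eq_or_lt with rfl | h0
    · obtain ⟨k, -, i, hi, hS, g1, g2⟩ := exists_ordinary ha hab hb 0
      refine ⟨⟨_, hT ⟨g1, lt_of_le_of_lt ?_ g2⟩, locDim_left hi hS⟩, by simp⟩
      gcongr
      linarith
    · obtain ⟨B, hB, hB', hB0⟩ := exists_hausdorffMeasure_ne_zero ha hab hb h0 h1
      have hnull := hausdorffMeasure_locDim_lt_eq_zero (μ := gapMeasure) h0
      have hsub : B \ {x | locDim gapMeasure x < (h : EReal)} ⊆
          {x ∈ T | locDim gapMeasure x = (h : EReal)} := fun x hx =>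
        ⟨hT (hB hx.1), (hB' x hx.1).antisymm (not_lt.1 hx.2)⟩
      rw [← measure_sdiff_null hnull] at hB0
      refine ⟨(nonempty_of_measure_ne_zero hB0).mono hsub, le_trans ?_ (dimH_mono hsub)⟩
      refine le_dimH_of_hausdorffMeasure_ne_zero (d := h.toNNReal) ?_
      rwa [Real.coe_toNNReal h h0.le]
  rw [dimHE, if_pos hne, (dimH_level_le h0 T).antisymm hge, EReal.coe_ennreal_ofReal,
    max_eq_left h0]

theorem dimHE_level_two (ha : 0 ≤ a) (hab : a < b) (hb : b ≤ 1) (hT : Ioo a b ⊆ T)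
    (hT1 : T ⊆ Icc 0 1) :
    dimHE {x ∈ T | locDim gapMeasure x = ((2 : ℝ) : EReal)} = 0 := by
  obtain ⟨x, hx, hx2⟩ := exists_centre ha hab hb
  have hsub : {x ∈ T | locDim gapMeasure x = ((2 : ℝ) : EReal)} ⊆ centres := by
    rintro y ⟨hy, hy2⟩
    by_contra hyc
    have := locDim_le_one (hT1 hy) hyc
    rw [hy2, EReal.coe_le_coe_iff] at this
    norm_num at this
  rw [dimHE, if_pos ⟨x, hT hx, hx2⟩, dimH_countable (countable_centres.mono hsub)]
  rfl

theorem dimHE_level_eq_bot (hT1 : T ⊆ Icc 0 1) {h : EReal}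
    (h1 : ∀ r ∈ Icc (0 : ℝ) 1, h ≠ (r : EReal)) (h2 : h ≠ ((2 : ℝ) : EReal)) :
    dimHE {x ∈ T | locDim gapMeasure x = h} = ⊥ := by
  refine if_neg ?_
  rintro ⟨x, hx, rfl⟩
  by_cases hxc : x ∈ centres
  · exact h2 (locDim_eq_two hxc)
  · have g1 := locDim_le_one (hT1 hx) hxc
    have g0 := locDim_nonneg (μ := gapMeasure) x
    lift locDim gapMeasure x to ℝ using
      ⟨(g1.trans_lt (EReal.coe_lt_top 1)).ne, (EReal.bot_lt_zero.trans_le g0).ne'⟩ with r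
    exact h1 r ⟨by exact_mod_cast g0, by exact_mod_cast g1⟩ rfl

theorem isHM_gapMeasure : IsHM gapMeasure := by
  intro a b ha hab hb h _
  have hT : Ioo a b ⊆ Icc 0 1 := fun x hx => ⟨ha.trans hx.1.le, hx.2.le.trans hb⟩
  rw [spec]
  by_cases h1 : ∃ r ∈ Icc (0 : ℝ) 1, h = (r : EReal)
  · obtain ⟨r, ⟨hr0, hr1⟩, rfl⟩ := h1
    rw [dimHE_level ha hab hb Subset.rfl hr0 hr1,
      dimHE_level le_rfl one_pos le_rfl Ioo_subset_Icc_self hr0 hr1]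
  push Not at h1
  by_cases h2 : h = ((2 : ℝ) : EReal)
  · rw [h2, dimHE_level_two ha hab hb Subset.rfl hT,
      dimHE_level_two le_rfl one_pos le_rfl Ioo_subset_Icc_self Subset.rfl]
  · rw [dimHE_level_eq_bot hT h1 h2, dimHE_level_eq_bot Subset.rfl h1 h2]

end GapMeasure

/-- There exists a non-atomic homogeneously multifractal Borel probability measure `μ`
on `[0,1]` with `d_μ(h) = h` for every `h ∈ [0,1]`, `d_μ(2) = 0`, and `d_μ(h) = -∞` for
every `h ∈ [0,∞) \ ([0,1] ∪ {2})`; in particular `Support(d_μ) = [0,1] ∪ {2}`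
has a gap above `1`. -/
theorem HM_measure_with_spectrum_gap :
    ∃ μ : Measure ℝ, IsProbabilityMeasure μ ∧ μ (Set.Icc (0:ℝ) 1)ᶜ = 0 ∧
      (∀ x : ℝ, μ {x} = 0) ∧ IsHM μ ∧
      (∀ h : ℝ, 0 ≤ h → h ≤ 1 → spec μ (h : EReal) = (h : EReal)) ∧
      spec μ ((2 : ℝ) : EReal) = 0 ∧
      (∀ h : ℝ, 0 ≤ h → h ∉ Set.Icc (0:ℝ) 1 → h ≠ 2 → spec μ (h : EReal) = ⊥) := by
  refine ⟨GapMeasure.gapMeasure, inferInstance, GapMeasure.gapMeasure_compl_Icc,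
    GapMeasure.gapMeasure_singleton, GapMeasure.isHM_gapMeasure, fun h h0 h1 => ?_, ?_,
    fun h _ h1 h2 => ?_⟩
  · exact GapMeasure.dimHE_level le_rfl one_pos le_rfl Ioo_subset_Icc_self h0 h1
  · exact GapMeasure.dimHE_level_two le_rfl one_pos le_rfl Ioo_subset_Icc_self Subset.rfl
  · refine GapMeasure.dimHE_level_eq_bot Subset.rfl (fun r hr hhr => h1 ?_) ?_
    · rwa [EReal.coe_eq_coe_iff.1 hhr]
    · exact fun hh => h2 (EReal.coe_eq_coe_iff.1 hh)
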